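/- arXiv:1910.02177 — 3 statements merged into one kernel-verified Lean document; each statement's English description precedes it below -/
import Mathlib

section
/- Let T be an invertible linear map on d×d complex matrices. Then T⁻¹∘𝓤∘T ∈ 𝕌 for every 𝓤 ∈ 𝕌 if and only if there exists a unitary or antiunitary transformation 𝓢 ∈ 𝕊 such that T⁻¹∘𝓤∘T = 𝓢⁻¹∘𝓤∘𝓢 for every 𝓤 ∈ 𝕌. -/
open Matrix

noncomputable section

/-- d×d complex matrices. -/
abbrev Mat (d : ℕ) := Matrix (Fin d) (Fin d) ℂ

/-- The set `𝕌` of unitary maps `A ↦ uAu†` on matrices. -/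
def UniMapSet (d : ℕ) : Set (Mat d →ₗ[ℂ] Mat d) :=
  {U | ∃ u ∈ Matrix.unitaryGroup (Fin d) ℂ, ∀ A, U A = u * A * uᴴ}

/-- The unitary (`anti = false`) or antiunitary (`anti = true`) transformation
`𝓢(A) = uAu†` resp. `𝓢(A) = uAᵀu†` associated with a unitary matrix `u`;
`𝕊` is the collection of these. -/
def Sfwd {d : ℕ} (u : Mat d) (anti : Bool) (A : Mat d) : Mat d :=
  if anti then u * Aᵀ * uᴴ else u * A * uᴴ

/-- The inverse of the transformation `Sfwd u anti`. -/
def Sinv {d : ℕ} (u : Mat d) (anti : Bool) (A : Mat d) : Mat d :=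
  if anti then (uᴴ * A * u)ᵀ else uᴴ * A * u

/-- A matrix commuting with everything is scalar. -/
lemma central_eq {d : ℕ} (hd : 2 ≤ d) (K : Mat d) (h : ∀ X : Mat d, K * X = X * K) :
    K = (K.trace / d) • (1 : Mat d) := by
  have h1 : K ∈ Set.range (Matrix.scalar (Fin d)) := by
    apply Matrix.mem_range_scalar_of_commute_single
    intro i j _
    exact (h _).symm
  obtain ⟨c, rfl⟩ := h1
  have hd0 : (d : ℂ) ≠ 0 := by
    have : d ≠ 0 := by omega
    exact_mod_cast this
  have : (Matrix.scalar (Fin d) c) = c • (1 : Mat d) := by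
    ext i j; simp [Matrix.one_apply, Matrix.diagonal_apply]
  rw [this]
  simp [Matrix.trace_smul, hd0]

/-- Derivations of the matrix algebra are inner. -/
lemma derivation_inner {d : ℕ} (hd : 2 ≤ d) (D : Mat d →ₗ[ℂ] Mat d)
    (hD : ∀ A B, D (A * B) = D A * B + A * D B) :
    ∃ K : Mat d, ∀ X, D X = K * X - X * K := by
  let z : Fin d := ⟨0, by omega⟩
  refine ⟨∑ i, D (Matrix.single i z 1) * Matrix.single z i 1, fun X => ?_⟩
  have h1 : ∑ i, D (X * Matrix.single i z 1) * Matrix.single z i 1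
      = D X + X * ∑ i, D (Matrix.single i z 1) * Matrix.single z i 1 := by
    have e1 : (∑ i : Fin d, Matrix.single i i (1 : ℂ)) = (1 : Mat d) := by
      ext a b
      simp [Matrix.sum_apply, Matrix.single_apply, Matrix.one_apply, ite_and]
    calc _ = ∑ i, (D X * Matrix.single i i 1
          + X * (D (Matrix.single i z 1) * Matrix.single z i 1)) := by
          refine Finset.sum_congr rfl fun i _ => ?_
          rw [hD, add_mul, mul_assoc, mul_assoc]
          simp
      _ = _ := by
          rw [Finset.sum_add_distrib, ← Finset.mul_sum, ← Finset.mul_sum, e1, mul_one]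
  have h2 : ∑ i, D (X * Matrix.single i z 1) * Matrix.single z i 1
      = (∑ i, D (Matrix.single i z 1) * Matrix.single z i 1) * X := by
    have e2 : ∀ i, X * Matrix.single i z 1 = ∑ j, X j i • Matrix.single j z (1 : ℂ) := by
      intro i
      ext a b
      simp [Matrix.sum_apply, Matrix.single_apply, Matrix.mul_apply, ite_and]
    have e3 : ∀ j, Matrix.single z j (1 : ℂ) * X = ∑ i, X j i • Matrix.single z i (1 : ℂ) := by
      intro i
      ext a b
      simp [Matrix.sum_apply, Matrix.single_apply, Matrix.mul_apply, ite_and]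
    simp_rw [e2, Finset.sum_mul, mul_assoc, e3, map_sum, map_smul, Finset.sum_mul,
      Finset.mul_sum, Matrix.smul_mul, Matrix.mul_smul]
    exact Finset.sum_comm
  rw [← h2, h1]; abel

/-- Laurent polynomials of degree two vanishing on the unit circle. -/
lemma laurent {d : ℕ} (x0 x1 y1 x2 y2 : Mat d)
    (h : ∀ z w : ℂ, z * w = 1 → star z = w →
      x0 + z • x1 + w • y1 + z ^ 2 • x2 + w ^ 2 • y2 = 0) :
    x1 = 0 ∧ y1 = 0 ∧ x2 = 0 ∧ y2 = 0 := by
  have I2 := Complex.I_mul_I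
  have key : ∀ a b : Fin d, x1 a b = 0 ∧ y1 a b = 0 ∧ x2 a b = 0 ∧ y2 a b = 0 := by
    intro a b
    have hs : ∀ z w : ℂ, z * w = 1 → star z = w →
        x0 a b + z * x1 a b + w * y1 a b + z ^ 2 * x2 a b + w ^ 2 * y2 a b = 0 := by
      intro z w h1 h2
      simpa using congrFun (congrFun (h z w h1 h2) a) b
    have a1 := hs 1 1 (by simp) (by simp)
    have a2 := hs (-1) (-1) (by simp) (by simp)
    have a3 := hs Complex.I (-Complex.I) (by simp) (by simp)
    have a4 := hs (-Complex.I) Complex.I (by simp) (by simp)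
    have a5 := hs ((3 + 4 * Complex.I) / 5) ((3 - 4 * Complex.I) / 5)
      (by linear_combination (-16/25) * I2)
      (by
        apply Complex.ext <;> simp)
    have b1 : x1 a b + y1 a b = 0 := by linear_combination (a1 - a2) / 2
    have b2 : x1 a b - y1 a b = 0 := by
      linear_combination (-Complex.I) * (a3 - a4) / 2 + (x1 a b - y1 a b) * I2
    have c1 : x1 a b = 0 := by linear_combination (b1 + b2) / 2
    have c2 : y1 a b = 0 := by linear_combination (b1 - b2) / 2
    have b3 : x2 a b + y2 a b = 0 := by
      linear_combination (a1 + a2 - a3 - a4) / 4 + (x2 a b + y2 a b) / 2 * I2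
    have b4 : x0 a b = 0 := by linear_combination a1 - c1 - c2 - b3
    rw [c1, c2, b4] at a5
    have c3 : x2 a b = 0 := by
      have e : y2 a b = - x2 a b := by linear_combination b3
      rw [e] at a5
      linear_combination (-25/48 * Complex.I) * a5 + x2 a b * I2
    have c4 : y2 a b = 0 := by linear_combination b3 - c3
    exact ⟨c1, c2, c3, c4⟩
  refine ⟨?_, ?_, ?_, ?_⟩ <;> ext a b
  · exact (key a b).1
  · exact (key a b).2.1
  · exact (key a b).2.2.1
  · exact (key a b).2.2.2

/-- The hypothesis in concrete form. -/
def Hyp {d : ℕ} (T : Mat d ≃ₗ[ℂ] Mat d) : Prop :=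
  ∀ u ∈ Matrix.unitaryGroup (Fin d) ℂ, ∃ v ∈ Matrix.unitaryGroup (Fin d) ℂ,
    ∀ A, T.symm (u * T A * uᴴ) = v * A * vᴴ

lemma uni_left {d : ℕ} {v : Mat d} (hv : v ∈ Matrix.unitaryGroup (Fin d) ℂ) : vᴴ * v = 1 :=
  Matrix.mem_unitaryGroup_iff'.1 hv

lemma uni_right {d : ℕ} {v : Mat d} (hv : v ∈ Matrix.unitaryGroup (Fin d) ℂ) : v * vᴴ = 1 :=
  Matrix.mem_unitaryGroup_iff.1 hv

lemma ad_proj {d : ℕ} (hd : 2 ≤ d) (T : Mat d ≃ₗ[ℂ] Mat d) (hT : Hyp T)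
    (P : Mat d) (hP : P * P = P) (hP' : Pᴴ = P) :
    ∃ K : Mat d, ∀ X, T.symm (P * T X - T X * P) = K * X - X * K := by
  let f0 : Mat d → Mat d := fun A => T.symm (P * T A * P + (1 - P) * T A * (1 - P))
  let f1 : Mat d → Mat d := fun A => T.symm (P * T A * (1 - P))
  let g1 : Mat d → Mat d := fun A => T.symm ((1 - P) * T A * P)
  have hG : ∀ z w : ℂ, z * w = 1 → star z = w → ∀ A B,
      f0 (A * B) + z • f1 (A * B) + w • g1 (A * B)
        = (f0 A + z • f1 A + w • g1 A) * (f0 B + z • f1 B + w • g1 B) := by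
    intro z w hzw hst
    have hst' : star w = z := by rw [← hst, star_star]
    have hu : (z • P + (1 - P)) ∈ Matrix.unitaryGroup (Fin d) ℂ := by
      rw [Matrix.mem_unitaryGroup_iff, Matrix.star_eq_conjTranspose]
      simp only [conjTranspose_add, conjTranspose_smul, conjTranspose_sub, conjTranspose_one,
        hP', hst, mul_add, add_mul, Matrix.smul_mul, Matrix.mul_smul, smul_smul, hP, mul_sub,
        sub_mul, one_mul, mul_one]
      rw [mul_comm w z, hzw]
      simp
    obtain ⟨v, hv, hvA⟩ := hT _ hu
    have hF : ∀ A, f0 A + z • f1 A + w • g1 A = v * A * vᴴ := by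
      intro A
      rw [← hvA A]
      simp only [f0, f1, g1, ← map_smul, ← map_add]
      congr 1
      simp only [conjTranspose_add, conjTranspose_smul, conjTranspose_sub, conjTranspose_one,
        hP', hst, add_mul, mul_add, Matrix.smul_mul, Matrix.mul_smul, smul_smul]
      rw [mul_comm w z, hzw]
      simp only [one_smul]
      abel
    intro A B
    rw [hF, hF, hF]
    calc v * (A * B) * vᴴ = v * A * 1 * B * vᴴ := by simp only [mul_one, mul_assoc]
      _ = _ := by rw [← uni_left hv]; simp only [mul_assoc]
  have hsum : ∀ A, f0 A + f1 A + g1 A = A := by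
    intro A
    simp only [f0, f1, g1, ← map_add]
    rw [LinearEquiv.symm_apply_eq]
    noncomm_ring
  let D : Mat d →ₗ[ℂ] Mat d := T.symm.toLinearMap ∘ₗ
    (LinearMap.mulLeft ℂ P - LinearMap.mulRight ℂ P) ∘ₗ T.toLinearMap
  have hD : ∀ X, D X = T.symm (P * T X - T X * P) := fun X => by simp [D]
  have hD' : ∀ X, D X = f1 X - g1 X := by
    intro X
    rw [hD]
    simp only [f1, g1, ← map_sub]
    congr 1
    noncomm_ring
  simp only [← hD]
  apply derivation_inner hd
  intro A B
  obtain ⟨h1, h2, h3, h4⟩ := laurent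
    (f0 A * f0 B + f1 A * g1 B + g1 A * f1 B - f0 (A * B))
    (f0 A * f1 B + f1 A * f0 B - f1 (A * B)) (f0 A * g1 B + g1 A * f0 B - g1 (A * B))
    (f1 A * f1 B) (g1 A * g1 B) (by
      intro z w hzw hst
      have := hG z w hzw hst A B
      rw [← sub_eq_zero] at this
      have h5 := neg_eq_zero.2 this
      rw [← h5]
      simp only [add_mul, mul_add, Matrix.smul_mul, Matrix.mul_smul, smul_smul, smul_sub, smul_add]
      rw [mul_comm w z, hzw, pow_two, pow_two]
      simp only [one_smul]
      abel)
  rw [sub_eq_zero] at h1 h2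
  rw [hD', hD', hD', ← h1, ← h2]
  conv_rhs => rw [← hsum A, ← hsum B]
  have e : (f1 (f0 A + f1 A + g1 A) - g1 (f0 A + f1 A + g1 A)) = f1 A - g1 A := by rw [hsum]
  have e' : (f1 (f0 B + f1 B + g1 B) - g1 (f0 B + f1 B + g1 B)) = f1 B - g1 B := by rw [hsum]
  rw [e, e']
  simp only [add_mul, mul_add, sub_mul, mul_sub, h3, h4]
  abel

lemma herm_diag {d : ℕ} (H : Mat d) (hH : Hᴴ = H) :
    ∃ u ∈ Matrix.unitaryGroup (Fin d) ℂ, ∃ c : Fin d → ℂ, H = u * Matrix.diagonal c * uᴴ := by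
  have h : H.IsHermitian := hH
  refine ⟨h.eigenvectorUnitary, h.eigenvectorUnitary.2,
    (RCLike.ofReal ∘ h.eigenvalues : Fin d → ℂ), ?_⟩
  have := h.spectral_theorem
  rw [Unitary.conjStarAlgAut_apply] at this
  exact this

lemma diag_sum {d : ℕ} (c : Fin d → ℂ) :
    Matrix.diagonal c = ∑ i, c i • Matrix.single i i (1 : ℂ) := by
  ext a b
  simp [Matrix.sum_apply, Matrix.single_apply, Matrix.diagonal_apply, ite_and]

lemma herm_decomp {d : ℕ} (A : Mat d) :
    ∃ H K : Mat d, Hᴴ = H ∧ Kᴴ = K ∧ A = H + Complex.I • K := by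
  refine ⟨(1 / 2 : ℂ) • (A + Aᴴ), (-Complex.I / 2) • (A - Aᴴ), ?_, ?_, ?_⟩
  · simp [add_comm]
  · simp only [conjTranspose_smul, conjTranspose_sub, conjTranspose_conjTranspose]
    simp
    module
  · rw [smul_smul]
    have : Complex.I * (-Complex.I / 2) = 1 / 2 := by
      linear_combination (-1 / 2) * Complex.I_mul_I
    rw [this]
    module

lemma ad_all {d : ℕ} (hd : 2 ≤ d) (T : Mat d ≃ₗ[ℂ] Mat d) (hT : Hyp T) (A : Mat d) :
    ∃ K : Mat d, ∀ X, T.symm (A * T X - T X * A) = K * X - X * K := by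
  let S : Submodule ℂ (Mat d) :=
    { carrier := {A | ∃ K : Mat d, ∀ X, T.symm (A * T X - T X * A) = K * X - X * K}
      zero_mem' := ⟨0, fun X => by simp⟩
      add_mem' := by
        rintro A B ⟨K, hK⟩ ⟨L, hL⟩
        refine ⟨K + L, fun X => ?_⟩
        have : (A + B) * T X - T X * (A + B) = (A * T X - T X * A) + (B * T X - T X * B) := by
          noncomm_ring
        rw [this, map_add, hK, hL]
        noncomm_ring
      smul_mem' := by
        rintro c A ⟨K, hK⟩
        refine ⟨c • K, fun X => ?_⟩
        have : (c • A) * T X - T X * (c • A) = c • (A * T X - T X * A) := by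
          simp [smul_sub]
        rw [this, map_smul, hK]
        simp [smul_sub] }
  have hH : ∀ H : Mat d, Hᴴ = H → H ∈ S := by
    intro H hH
    obtain ⟨u, hu, c, rfl⟩ := herm_diag H hH
    rw [diag_sum, Finset.mul_sum, Finset.sum_mul]
    refine S.sum_mem fun i _ => ?_
    rw [Matrix.mul_smul, Matrix.smul_mul]
    refine S.smul_mem _ ?_
    refine ad_proj hd T hT _ ?_ ?_
    · calc _ = u * Matrix.single i i 1 * (uᴴ * u) * Matrix.single i i 1 * uᴴ := by
            simp only [mul_assoc]
        _ = _ := by rw [uni_left hu]; simp [mul_assoc]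
    · simp [conjTranspose_mul, mul_assoc]
  obtain ⟨H, K, h1, h2, rfl⟩ := herm_decomp A
  exact S.add_mem (hH _ h1) (S.smul_mem _ (hH _ h2))

lemma ad_unique {d : ℕ} (hd : 2 ≤ d) (K L : Mat d) (ht : K.trace = L.trace)
    (h : ∀ X, K * X - X * K = L * X - X * L) : K = L := by
  have := central_eq hd (K - L) (fun X => by
    have := h X
    rw [← sub_eq_zero] at this ⊢
    rw [← this]; noncomm_ring)
  rw [trace_sub, ht, sub_self, zero_div, zero_smul, sub_eq_zero] at this
  exact this

lemma exists_phi {d : ℕ} (hd : 2 ≤ d) (T : Mat d ≃ₗ[ℂ] Mat d) (hT : Hyp T) :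
    ∃ φ : Mat d →ₗ[ℂ] Mat d, (∀ A X, T.symm (A * T X - T X * A) = φ A * X - X * φ A) ∧
      ∀ A, (φ A).trace = A.trace := by
  have hd0 : (d : ℂ) ≠ 0 := by
    have : d ≠ 0 := by omega
    exact_mod_cast this
  have h : ∀ A : Mat d, ∃ K : Mat d, (∀ X, T.symm (A * T X - T X * A) = K * X - X * K) ∧
      K.trace = A.trace := by
    intro A
    obtain ⟨K, hK⟩ := ad_all hd T hT A
    refine ⟨K + ((A.trace - K.trace) / d) • (1 : Mat d), fun X => ?_, ?_⟩
    · rw [hK]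
      simp [add_mul, mul_add]
    · simp [trace_add, trace_smul, hd0]
  choose f hf ht using h
  refine ⟨{ toFun := f, map_add' := ?_, map_smul' := ?_ }, hf, ht⟩
  · intro A B
    apply ad_unique hd
    · simp [ht, trace_add]
    · intro X
      have : (A + B) * T X - T X * (A + B) = (A * T X - T X * A) + (B * T X - T X * B) := by
          noncomm_ring
      rw [← hf, this, map_add, hf, hf]
      noncomm_ring
  · intro c A
    apply ad_unique hd
    · simp [ht, trace_smul]
    · intro X
      have : (c • A) * T X - T X * (c • A) = c • (A * T X - T X * A) := by
          simp [smul_sub]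
      rw [← hf, this, map_smul, hf]
      simp [smul_sub]

lemma phi_equivariant {d : ℕ} (hd : 2 ≤ d) (T : Mat d ≃ₗ[ℂ] Mat d) (φ : Mat d →ₗ[ℂ] Mat d)
    (h1 : ∀ A X, T.symm (A * T X - T X * A) = φ A * X - X * φ A)
    (h2 : ∀ A, (φ A).trace = A.trace) (u v : Mat d)
    (hu : u ∈ Matrix.unitaryGroup (Fin d) ℂ) (hv : v ∈ Matrix.unitaryGroup (Fin d) ℂ)
    (huv : ∀ A, T.symm (u * T A * uᴴ) = v * A * vᴴ) (A : Mat d) :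
    φ (u * A * uᴴ) = v * φ A * vᴴ := by
  apply ad_unique hd
  · rw [h2, trace_mul_cycle, uni_left hu, one_mul, trace_mul_cycle, uni_left hv, one_mul, h2]
  · intro X
    rw [← h1]
    obtain ⟨Y, rfl⟩ : ∃ Y, X = v * Y * vᴴ := ⟨vᴴ * X * v, by
      calc X = (v * vᴴ) * X * (v * vᴴ) := by simp [uni_right hv]
        _ = _ := by simp only [mul_assoc]⟩
    have e : T (v * Y * vᴴ) = u * T Y * uᴴ := by rw [← huv]; simp
    have cj : ∀ w : Mat d, wᴴ * w = 1 → ∀ A B : Mat d,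
        (w * A * wᴴ) * (w * B * wᴴ) = w * (A * B) * wᴴ := by
      intro w hw A B
      calc _ = w * A * (wᴴ * w) * B * wᴴ := by simp only [mul_assoc]
        _ = _ := by rw [hw]; simp only [mul_assoc, one_mul]
    rw [e, cj u (uni_left hu), cj u (uni_left hu), cj v (uni_left hv), cj v (uni_left hv),
      ← sub_mul, ← mul_sub, ← sub_mul, ← mul_sub, ← h1, ← huv]
    simp

lemma phi_lie {d : ℕ} (hd : 2 ≤ d) (T : Mat d ≃ₗ[ℂ] Mat d) (φ : Mat d →ₗ[ℂ] Mat d)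
    (h1 : ∀ A X, T.symm (A * T X - T X * A) = φ A * X - X * φ A)
    (h2 : ∀ A, (φ A).trace = A.trace) (A B : Mat d) :
    φ (A * B - B * A) = φ A * φ B - φ B * φ A := by
  apply ad_unique hd
  · rw [h2, trace_sub, trace_sub, trace_mul_comm A B, trace_mul_comm (φ A)]; simp
  · intro X
    have h1' : ∀ A X, T (φ A * X - X * φ A) = A * T X - T X * A := by
      intro A X; rw [← h1]; simp
    rw [← h1]
    have e : (A * B - B * A) * T X - T X * (A * B - B * A)
        = (A * (B * T X - T X * B) - (B * T X - T X * B) * A)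
          - (B * (A * T X - T X * A) - (A * T X - T X * A) * B) := by noncomm_ring
    rw [e, ← h1' B X, ← h1' A X, map_sub, h1, h1]
    noncomm_ring

lemma phi_one {d : ℕ} (hd : 2 ≤ d) (T : Mat d ≃ₗ[ℂ] Mat d) (φ : Mat d →ₗ[ℂ] Mat d)
    (h1 : ∀ A X, T.symm (A * T X - T X * A) = φ A * X - X * φ A)
    (h2 : ∀ A, (φ A).trace = A.trace) : φ 1 = 1 := by
  apply ad_unique hd
  · rw [h2]
  · intro X
    rw [← h1]; simp

lemma trace_sandwich {d : ℕ} (A B : Mat d) :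
    LinearMap.trace ℂ (Mat d) (LinearMap.mulLeft ℂ A ∘ₗ LinearMap.mulRight ℂ B)
      = A.trace * B.trace := by
  rw [LinearMap.trace_eq_matrix_trace ℂ (Matrix.stdBasis ℂ (Fin d) (Fin d)), Matrix.trace]
  simp only [Matrix.diag_apply, LinearMap.toMatrix_apply]
  rw [Fintype.sum_prod_type]
  have : ∀ i j : Fin d, ((Matrix.stdBasis ℂ (Fin d) (Fin d)).repr
      ((LinearMap.mulLeft ℂ A ∘ₗ LinearMap.mulRight ℂ B)
        ((Matrix.stdBasis ℂ (Fin d) (Fin d)) (i, j)))) (i, j) = A i i * B j j := by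
    intro i j
    rw [Matrix.stdBasis_eq_single]
    have : ∀ M : Mat d, (Matrix.stdBasis ℂ (Fin d) (Fin d)).repr M (i, j) = M i j := by
      intro M; simp [Matrix.stdBasis]
    rw [this]
    simp [Matrix.mul_apply, Matrix.single_apply, ite_and]
  simp only [this]
  simp [Matrix.trace, Finset.sum_mul_sum]

/-- The map `X ↦ [A, X]`. -/
def adm {d : ℕ} (A : Mat d) : Mat d →ₗ[ℂ] Mat d :=
  LinearMap.mulLeft ℂ A - LinearMap.mulRight ℂ A

lemma trace_adm {d : ℕ} (A B : Mat d) :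
    LinearMap.trace ℂ (Mat d) (adm A ∘ₗ adm B)
      = 2 * (d * (A * B).trace - A.trace * B.trace) := by
  have : adm A ∘ₗ adm B = LinearMap.mulLeft ℂ (A * B) ∘ₗ LinearMap.mulRight ℂ 1
      - LinearMap.mulLeft ℂ A ∘ₗ LinearMap.mulRight ℂ B
      - LinearMap.mulLeft ℂ B ∘ₗ LinearMap.mulRight ℂ A
      + LinearMap.mulLeft ℂ 1 ∘ₗ LinearMap.mulRight ℂ (B * A) := by
    ext1 X
    simp [adm]
    noncomm_ring
  rw [this, map_add, map_sub, map_sub]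
  simp only [trace_sandwich]
  rw [trace_mul_comm B A]
  simp
  ring

lemma phi_trace {d : ℕ} (hd : 2 ≤ d) (T : Mat d ≃ₗ[ℂ] Mat d) (φ : Mat d →ₗ[ℂ] Mat d)
    (h1 : ∀ A X, T.symm (A * T X - T X * A) = φ A * X - X * φ A)
    (h2 : ∀ A, (φ A).trace = A.trace) (A B : Mat d) :
    (φ A * φ B).trace = (A * B).trace := by
  have hd0 : (d : ℂ) ≠ 0 := by
    have : d ≠ 0 := by omega
    exact_mod_cast this
  have h1' : ∀ A X, T (φ A * X - X * φ A) = A * T X - T X * A := by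
    intro A X; rw [← h1]; simp
  have e : adm (φ A) ∘ₗ adm (φ B) = T.symm.conj (adm A ∘ₗ adm B) := by
    ext1 X
    simp only [LinearEquiv.conj_apply_apply, LinearMap.comp_apply, adm, LinearMap.sub_apply,
      LinearMap.mulLeft_apply, LinearMap.mulRight_apply, LinearEquiv.symm_symm]
    rw [← h1', h1]
  have e2 := congrArg (LinearMap.trace ℂ (Mat d)) e
  rw [LinearMap.trace_conj', trace_adm, trace_adm, h2, h2] at e2
  have e3 : (d : ℂ) * (φ A * φ B).trace = d * (A * B).trace := by linear_combination e2 / 2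
  exact mul_left_cancel₀ hd0 e3

lemma contract {d : ℕ} (L R : Mat d) (i a : Fin d) :
    ∑ b, (L * Matrix.single a b (1 : ℂ) * R : Mat d) i b = L i a * R.trace := by
  simp [Matrix.mul_apply, Matrix.single_apply, ite_and, Matrix.trace, Finset.mul_sum]

lemma quad {d : ℕ} (hd : 2 ≤ d) (K : Mat d) (t1 : K.trace = 1) (t2 : (K * K).trace = 1)
    (hc : ∀ X, K * K * K * X * 1 - (3 : ℂ) • (K * K * X * K) + (3 : ℂ) • (K * X * (K * K))
      - 1 * X * (K * K * K) = K * X * 1 - 1 * X * K) :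
    K * K = K ∨ ((2 / d : ℂ) • 1 - K) * ((2 / d : ℂ) • 1 - K) = (2 / d : ℂ) • 1 - K := by
  have hd0 : (d : ℂ) ≠ 0 := by
    have : d ≠ 0 := by omega
    exact_mod_cast this
  have hd1 : (d : ℂ) - 1 ≠ 0 := by
    rw [sub_ne_zero]
    have : d ≠ 1 := by omega
    exact_mod_cast this
  set t3 := (K * K * K).trace with ht3
  set t4 := (K * K * K * K).trace with ht4
  have c1 : ∀ i a, (K * K * K) i a * d - 3 * (K * K) i a + 3 * K i a - (1 : Mat d) i a * t3
      = K i a * d - (1 : Mat d) i a := by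
    intro i a
    have := Finset.sum_congr rfl (fun b (_ : b ∈ (Finset.univ : Finset (Fin d))) =>
      congrFun (congrFun (hc (Matrix.single a b 1)) i) b)
    simp only [Matrix.add_apply, Matrix.sub_apply, Matrix.smul_apply, smul_eq_mul,
      Finset.sum_add_distrib, Finset.sum_sub_distrib, ← Finset.mul_sum, contract] at this
    rw [t1, t2] at this
    simp only [trace_one, Fintype.card_fin] at this
    linear_combination this
  have c2 : ∀ i a, (K * K * K) i a - 3 * (K * K) i a + 3 * K i a * t3 - (1 : Mat d) i a * t4
      = K i a - (1 : Mat d) i a := by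
    intro i a
    have hc' : ∀ X, K * K * K * X * K - (3 : ℂ) • (K * K * X * (K * K))
        + (3 : ℂ) • (K * X * (K * K * K)) - 1 * X * (K * K * K * K)
          = K * X * K - 1 * X * (K * K) := by
      intro X
      have := congrArg (· * K) (hc X)
      simpa only [add_mul, sub_mul, Matrix.smul_mul, mul_assoc, one_mul, mul_one] using this
    have := Finset.sum_congr rfl (fun b (_ : b ∈ (Finset.univ : Finset (Fin d))) =>
      congrFun (congrFun (hc' (Matrix.single a b 1)) i) b)
    simp only [Matrix.add_apply, Matrix.sub_apply, Matrix.smul_apply, smul_eq_mul,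
      Finset.sum_add_distrib, Finset.sum_sub_distrib, ← Finset.mul_sum, contract] at this
    rw [t1, t2] at this
    linear_combination this
  obtain ⟨α, β, hK⟩ : ∃ α β : ℂ, K * K = α • K + β • (1 : Mat d) := by
    refine ⟨(d * t3 - 1) / (d - 1), (t3 - 1 - d * (t4 - 1)) / (3 * (d - 1)), ?_⟩
    ext i a
    simp only [Matrix.add_apply, Matrix.smul_apply, smul_eq_mul]
    field_simp
    linear_combination c1 i a - d * c2 i a
  have hβ : 1 = α + d * β := by
    have := congrArg Matrix.trace hK
    rw [t2, trace_add, trace_smul, trace_smul, t1, trace_one] at this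
    simp at this
    linear_combination this
  have hγ : 4 * β + α ^ 2 = 1 := by
    by_contra hne
    have hne' : 4 * β + α ^ 2 - 1 ≠ 0 := sub_ne_zero.2 hne
    have hcomm : ∀ X, K * X = X * K := by
      intro X
      have h := hc X
      have k3 : K * K * K = (α ^ 2 + β) • K + (α * β) • (1 : Mat d) := by
        rw [hK, add_mul, Matrix.smul_mul, hK, Matrix.smul_mul, one_mul]
        module
      rw [k3, hK] at h
      simp only [add_mul, mul_add, Matrix.smul_mul, Matrix.mul_smul, one_mul, mul_one] at h
      have : (4 * β + α ^ 2 - 1) • (K * X - X * K) = 0 := by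
        rw [← sub_eq_zero] at h
        rw [← h]
        module
      rcases smul_eq_zero.1 this with h | h
      · exact absurd h hne'
      · exact sub_eq_zero.1 h
    have hs := central_eq hd K hcomm
    rw [t1] at hs
    rw [hs] at t2
    simp [trace_smul] at t2
    field_simp at t2
    apply hd1
    linear_combination -t2
  have hf : (α - 1) * (d * α + d - 4) = 0 := by
    linear_combination 4 * hβ + (d : ℂ) * hγ
  rcases mul_eq_zero.1 hf with h | h
  · left
    have ha : α = 1 := by linear_combination h
    have hb : β = 0 := by rw [ha] at hγ; linear_combination hγ / 4
    rw [hK, ha, hb]; simp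
  · right
    have ha : α = 4 / d - 1 := by field_simp; linear_combination h
    have hb : β = 2 / d - (2 / d) * (2 / d) := by
      rw [ha] at hγ; linear_combination hγ / 4
    simp only [sub_mul, mul_sub, Matrix.smul_mul, Matrix.mul_smul, one_mul, mul_one, hK, smul_smul]
    rw [ha, hb]
    module

lemma conj_conj {d : ℕ} {w : Mat d} (hw : w ∈ Matrix.unitaryGroup (Fin d) ℂ) (A B : Mat d) :
    (w * A * wᴴ) * (w * B * wᴴ) = w * (A * B) * wᴴ := by
  calc _ = w * A * (wᴴ * w) * B * wᴴ := by simp only [mul_assoc]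
    _ = _ := by rw [uni_left hw]; simp only [mul_assoc, one_mul]

/-- Permutation matrix of a transposition. -/
lemma swap_uni {d : ℕ} (i j : Fin d) :
    ∃ u ∈ Matrix.unitaryGroup (Fin d) ℂ,
      ∀ M : Mat d, u * M * uᴴ = M.submatrix (Equiv.swap i j) (Equiv.swap i j) := by
  have h : ∀ M : Mat d, ((1 : Mat d).submatrix (Equiv.swap i j) id) * M
      * ((1 : Mat d).submatrix (Equiv.swap i j) id)ᴴ
        = M.submatrix (Equiv.swap i j) (Equiv.swap i j) := by
    intro M
    ext a b
    simp [Matrix.mul_apply, Matrix.one_apply]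
  refine ⟨(1 : Mat d).submatrix (Equiv.swap i j) id, ?_, h⟩
  rw [Matrix.mem_unitaryGroup_iff, Matrix.star_eq_conjTranspose]
  have := h 1
  rw [mul_one] at this
  rw [this]
  simp

lemma idem_trace {d : ℕ} (M : Mat d) (h : M * M = M) (ht : M.trace = 0) : M = 0 := by
  have h1 : IsIdempotentElem (Matrix.toLin' M) := by
    rw [IsIdempotentElem, Module.End.mul_eq_comp, ← Matrix.toLin'_mul, h]
  have h2 := (LinearMap.IsIdempotentElem.trace_eq_zero_iff h1).1 (by
    rw [Matrix.trace_toLin'_eq, ht])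
  simpa using h2

lemma jordan {d : ℕ} (z : Fin d) (ψ : Mat d →ₗ[ℂ] Mat d)
    (hcom : ∀ A B, A * B = B * A → ψ A * ψ B = ψ B * ψ A)
    (htr : ∀ A B, (ψ A * ψ B).trace = (A * B).trace)
    (heq : ∀ u ∈ Matrix.unitaryGroup (Fin d) ℂ, ∃ v ∈ Matrix.unitaryGroup (Fin d) ℂ,
      ∀ A, ψ (u * A * uᴴ) = v * ψ A * vᴴ)
    (hz : ψ (Matrix.single z z 1) * ψ (Matrix.single z z 1) = ψ (Matrix.single z z 1))
    (A B : Mat d) : ψ (A * B + B * A) = ψ A * ψ B + ψ B * ψ A := by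
  have hi : ∀ i, ψ (Matrix.single i i 1) * ψ (Matrix.single i i 1) = ψ (Matrix.single i i 1) := by
    intro i
    obtain ⟨u, hu, hM⟩ := swap_uni i z
    obtain ⟨v, hv, hA⟩ := heq u hu
    have e : Matrix.single i i (1 : ℂ) = u * Matrix.single z z 1 * uᴴ := by
      rw [hM]
      ext a b
      simp only [Matrix.submatrix_apply, Matrix.single_apply]
      congr 1
      simp [Equiv.swap_apply_eq_iff, eq_comm (a := z), eq_comm (a := i)]
    rw [e, hA, conj_conj hv, hz]
  have hij : ∀ i j, i ≠ j → ψ (Matrix.single i i 1) * ψ (Matrix.single j j 1) = 0 := by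
    intro i j hne
    have h0 : Matrix.single i i (1 : ℂ) * Matrix.single j j 1 = (0 : Mat d) := by
      simp [hne]
    have h0' : Matrix.single j j (1 : ℂ) * Matrix.single i i 1 = (0 : Mat d) := by
      simp [hne.symm]
    have hc := hcom (Matrix.single i i 1) (Matrix.single j j 1) (by rw [h0, h0'])
    apply idem_trace
    · calc _ = ψ (Matrix.single i i 1) * (ψ (Matrix.single j j 1) * ψ (Matrix.single i i 1))
            * ψ (Matrix.single j j 1) := by simp only [mul_assoc]
        _ = ψ (Matrix.single i i 1) * ψ (Matrix.single i i 1)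
            * (ψ (Matrix.single j j 1) * ψ (Matrix.single j j 1)) := by
              rw [← hc]; simp only [mul_assoc]
        _ = _ := by rw [hi, hi]
    · rw [htr, h0]; simp
  have hdiag : ∀ c : Fin d → ℂ, ψ (Matrix.diagonal c * Matrix.diagonal c)
      = ψ (Matrix.diagonal c) * ψ (Matrix.diagonal c) := by
    intro c
    rw [Matrix.diagonal_mul_diagonal, diag_sum, diag_sum c]
    simp only [map_sum, map_smul, Finset.sum_mul, Finset.mul_sum, Matrix.smul_mul,
      Matrix.mul_smul]
    refine Finset.sum_congr rfl fun i _ => ?_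
    rw [Finset.sum_eq_single i]
    · rw [hi, smul_smul]
    · intro j _ hj
      rw [hij _ _ hj]; simp
    · simp
  have hsq : ∀ H : Mat d, Hᴴ = H → ψ (H * H) = ψ H * ψ H := by
    intro H hH
    obtain ⟨u, hu, c, rfl⟩ := herm_diag H hH
    obtain ⟨v, hv, hA⟩ := heq u hu
    rw [conj_conj hu, hA, hA, conj_conj hv, hdiag]
  have hHH : ∀ H K : Mat d, Hᴴ = H → Kᴴ = K → ψ (H * K + K * H) = ψ H * ψ K + ψ K * ψ H := by
    intro H K hH hK
    have h1 := hsq (H + K) (by rw [conjTranspose_add, hH, hK])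
    simp only [map_add, add_mul, mul_add, hsq H hH, hsq K hK] at h1
    rw [map_add]
    rw [← sub_eq_zero] at h1 ⊢
    rw [← h1]; abel
  obtain ⟨A1, A2, ha1, ha2, rfl⟩ := herm_decomp A
  obtain ⟨B1, B2, hb1, hb2, rfl⟩ := herm_decomp B
  have e : (A1 + Complex.I • A2) * (B1 + Complex.I • B2)
      + (B1 + Complex.I • B2) * (A1 + Complex.I • A2)
      = (A1 * B1 + B1 * A1) + Complex.I • (A1 * B2 + B2 * A1)
        + Complex.I • (A2 * B1 + B1 * A2)
        + (Complex.I * Complex.I) • (A2 * B2 + B2 * A2) := by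
    simp only [add_mul, mul_add, Matrix.smul_mul, Matrix.mul_smul]
    module
  rw [e]
  simp only [map_add _ (_ + _), map_smul, hHH _ _ ha1 hb1, hHH _ _ ha1 hb2, hHH _ _ ha2 hb1,
    hHH _ _ ha2 hb2]
  simp only [map_add, map_smul, add_mul, mul_add, Matrix.smul_mul, Matrix.mul_smul]
  module

lemma scalar_of_uni {d : ℕ} (z : Fin d) (N : Mat d) (hN : Nᴴ = N)
    (h : ∀ u ∈ Matrix.unitaryGroup (Fin d) ℂ, u * N * uᴴ = N) : ∃ s : ℂ, N = s • (1 : Mat d) := by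
  obtain ⟨w, hw, c, rfl⟩ := herm_diag N hN
  have hw' : wᴴ ∈ Matrix.unitaryGroup (Fin d) ℂ := by
    rw [Matrix.mem_unitaryGroup_iff, Matrix.star_eq_conjTranspose, conjTranspose_conjTranspose,
      uni_left hw]
  have hD : w * Matrix.diagonal c * wᴴ = Matrix.diagonal c := by
    rw [← h _ hw']
    calc _ = (wᴴ * w) * Matrix.diagonal c * (wᴴ * w) := by
          simp only [conjTranspose_conjTranspose, mul_assoc]
      _ = _ := by rw [uni_left hw]; simp
  rw [hD] at h ⊢
  refine ⟨c z, ?_⟩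
  ext a b
  by_cases hab : a = b
  · subst hab
    obtain ⟨u, hu, hM⟩ := swap_uni a z
    have := h u hu
    rw [hM] at this
    have := congrFun (congrFun this a) a
    simpa using this.symm
  · simp [hab]

open scoped ComplexOrder in
lemma hom_unitary {d : ℕ} (hd : 2 ≤ d) (χ : Mat d →ₗ[ℂ] Mat d) (hinj : Function.Injective χ)
    (hone : χ 1 = 1) (hmul : ∀ A B, χ (A * B) = χ A * χ B)
    (heq : ∀ u ∈ Matrix.unitaryGroup (Fin d) ℂ, ∃ v ∈ Matrix.unitaryGroup (Fin d) ℂ,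
      ∀ A, χ (u * A * uᴴ) = v * χ A * vᴴ) :
    ∃ w ∈ Matrix.unitaryGroup (Fin d) ℂ, ∀ A, χ A = w * A * wᴴ := by
  have hd0 : (d : ℂ) ≠ 0 := by
    have : d ≠ 0 := by omega
    exact_mod_cast this
  obtain ⟨g, gi, hggi, hgig, hχ⟩ : ∃ g gi : Mat d, g * gi = 1 ∧ gi * g = 1 ∧
      ∀ A, χ A = g * A * gi := by
    let e : Mat d ≃ₐ[ℂ] Mat d := AlgEquiv.ofBijective (AlgHom.ofLinearMap χ hone hmul)
      ⟨hinj, LinearMap.injective_iff_surjective.1 hinj⟩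
    obtain ⟨S, hS⟩ := AlgEquiv.eq_linearEquivConjAlgEquiv
      ((Matrix.toLinAlgEquiv' (R := ℂ) (n := Fin d)).symm.trans
        (e.trans (Matrix.toLinAlgEquiv' (R := ℂ) (n := Fin d))))
    refine ⟨LinearMap.toMatrix' S.toLinearMap, LinearMap.toMatrix' S.symm.toLinearMap,
      ?_, ?_, fun A => ?_⟩
    · rw [← LinearMap.toMatrix'_comp]; simp
    · rw [← LinearMap.toMatrix'_comp]; simp
    · have h1 := congrArg (fun f => f (Matrix.toLin' A)) hS
      have h2 : Matrix.toLin' (χ A) = S.toLinearMap ∘ₗ Matrix.toLin' A ∘ₗ S.symm.toLinearMap := by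
        have h3 : (Matrix.toLinAlgEquiv' (R := ℂ) (n := Fin d)).symm (Matrix.toLin' A) = A :=
          LinearMap.toMatrix'_toLin' A
        simp only [AlgEquiv.trans_apply, h3] at h1
        exact h1
      have h4 := congrArg LinearMap.toMatrix' h2
      rw [LinearMap.toMatrix'_toLin', LinearMap.toMatrix'_comp, LinearMap.toMatrix'_comp,
        LinearMap.toMatrix'_toLin'] at h4
      rw [h4, mul_assoc]
  have hN0 : (gᴴ * g).trace ≠ 0 := by
    intro h
    rw [Matrix.trace_conjTranspose_mul_self_eq_zero_iff] at h
    rw [h, zero_mul] at hggi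
    have := congrFun (congrFun hggi ⟨0, by omega⟩) ⟨0, by omega⟩
    simp at this
  have hN : ∀ u ∈ Matrix.unitaryGroup (Fin d) ℂ, uᴴ * (gᴴ * g) * u = gᴴ * g := by
    intro u hu
    obtain ⟨v, hv, hA⟩ := heq u hu
    have hc := central_eq hd (gi * vᴴ * g * u) (fun X => by
      have h1 := hA X
      rw [hχ, hχ] at h1
      calc gi * vᴴ * g * u * X = gi * vᴴ * (g * (u * X * uᴴ) * gi) * g * u := by
            have : g * (u * X * uᴴ) * gi * g * u = g * u * X := by
              calc _ = g * u * X * uᴴ * (gi * g) * u := by simp only [mul_assoc]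
                _ = g * u * X * (uᴴ * u) := by rw [hgig]; simp only [mul_assoc, one_mul]
                _ = _ := by rw [uni_left hu, mul_one]
            simp only [mul_assoc] at this ⊢
            rw [this]
        _ = gi * (vᴴ * v) * g * X * gi * vᴴ * g * u := by rw [h1]; simp only [mul_assoc]
        _ = (gi * g) * X * gi * vᴴ * g * u := by rw [uni_left hv, mul_one]
        _ = _ := by rw [hgig, one_mul]; simp only [mul_assoc])
    obtain ⟨c, hc⟩ : ∃ c : ℂ, gi * vᴴ * g * u = c • (1 : Mat d) := ⟨_, hc⟩
    have hgu : g * u = c • (v * g) := by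
      calc g * u = v * vᴴ * (g * u) := by rw [uni_right hv, one_mul]
        _ = v * (g * gi) * vᴴ * g * u := by rw [hggi, mul_one]; simp only [mul_assoc]
        _ = v * g * (gi * vᴴ * g * u) := by simp only [mul_assoc]
        _ = _ := by rw [hc]; simp
    have h2 : uᴴ * (gᴴ * g) * u = (star c * c) • (gᴴ * g) := by
      calc uᴴ * (gᴴ * g) * u = (g * u)ᴴ * (g * u) := by
            rw [conjTranspose_mul]; simp only [mul_assoc]
        _ = (star c * c) • (gᴴ * (vᴴ * v) * g) := by
            rw [hgu, conjTranspose_smul, conjTranspose_mul, Matrix.smul_mul, Matrix.mul_smul,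
              smul_smul]
            simp only [mul_assoc]
        _ = _ := by rw [uni_left hv, mul_one]
    have h3 := congrArg Matrix.trace h2
    rw [trace_mul_comm, ← mul_assoc, uni_right hu, one_mul, trace_smul, smul_eq_mul] at h3
    have h4 : star c * c = 1 := by
      apply mul_right_cancel₀ hN0
      rw [← h3, one_mul]
    rw [h2, h4, one_smul]
  obtain ⟨s, hs⟩ := scalar_of_uni (⟨0, by omega⟩ : Fin d) (gᴴ * g)
    (by rw [conjTranspose_mul, conjTranspose_conjTranspose])
    (fun u hu => by
      have hu' : uᴴ ∈ Matrix.unitaryGroup (Fin d) ℂ := by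
        rw [Matrix.mem_unitaryGroup_iff, Matrix.star_eq_conjTranspose,
          conjTranspose_conjTranspose, uni_left hu]
      have := hN _ hu'
      rwa [conjTranspose_conjTranspose] at this)
  have hs0 : s ≠ 0 := by
    rintro rfl
    rw [hs] at hN0
    simp at hN0
  have hspos : 0 ≤ s := by
    have := (Matrix.posSemidef_conjTranspose_mul_self g).diag_nonneg (i := ⟨0, by omega⟩)
    rw [hs] at this
    simpa using this
  obtain ⟨r, hr, hrs⟩ : ∃ r : ℂ, star r = r ∧ r * r = s := by
    refine ⟨(Real.sqrt s.re : ℂ), by simp, ?_⟩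
    rw [Complex.nonneg_iff] at hspos
    rw [← Complex.ofReal_mul, Real.mul_self_sqrt hspos.1]
    apply Complex.ext
    · simp
    · simpa using hspos.2
  have hr0 : r ≠ 0 := by rintro rfl; exact hs0 (by rw [← hrs]; simp)
  refine ⟨r⁻¹ • g, ?_, fun A => ?_⟩
  · rw [Matrix.mem_unitaryGroup_iff', Matrix.star_eq_conjTranspose, conjTranspose_smul, star_inv₀,
      hr, Matrix.smul_mul, Matrix.mul_smul, hs, smul_smul, smul_smul, ← hrs]
    field_simp
    simp
  · have hgi : gᴴ = s • gi := by
      calc gᴴ = (gᴴ * g) * gi := by rw [mul_assoc, hggi, mul_one]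
        _ = _ := by rw [hs]; simp
    rw [hχ, conjTranspose_smul, star_inv₀, hr, hgi]
    simp only [Matrix.smul_mul, Matrix.mul_smul, smul_smul]
    rw [← hrs]
    have : r⁻¹ * (r⁻¹ * (r * r)) = 1 := by field_simp
    first
      | rw [this, one_smul]
      | (have : (r⁻¹ * (r * r)) * r⁻¹ = 1 := by field_simp
         simp [this])

open scoped ComplexOrder in
lemma inj_of_trace {d : ℕ} (φ : Mat d →ₗ[ℂ] Mat d)
    (htr : ∀ A B, (φ A * φ B).trace = (A * B).trace) : Function.Injective φ := by
  rw [injective_iff_map_eq_zero]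
  intro A hA
  have := htr A Aᴴ
  rw [hA, zero_mul, trace_zero] at this
  exact Matrix.trace_mul_conjTranspose_self_eq_zero_iff.1 this.symm

lemma uni_conj {d : ℕ} {v : Mat d} (hv : v ∈ Matrix.unitaryGroup (Fin d) ℂ) :
    vᴴ ∈ Matrix.unitaryGroup (Fin d) ℂ := by
  rw [Matrix.mem_unitaryGroup_iff, Matrix.star_eq_conjTranspose, conjTranspose_conjTranspose,
    uni_left hv]

lemma hth {d : ℕ} (u : Mat d) : ((uᴴ)ᵀ)ᴴ = uᵀ := by
  ext a b
  simp only [Matrix.conjTranspose_apply, Matrix.transpose_apply, star_star]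

lemma uni_trans {d : ℕ} {v : Mat d} (hv : v ∈ Matrix.unitaryGroup (Fin d) ℂ) :
    vᵀ ∈ Matrix.unitaryGroup (Fin d) ℂ := by
  rw [Matrix.mem_unitaryGroup_iff, Matrix.star_eq_conjTranspose]
  have := congrArg Matrix.transpose (uni_left hv)
  rw [transpose_mul, transpose_one] at this
  exact this

lemma forward {d : ℕ} (hd : 2 ≤ d) (T : Mat d ≃ₗ[ℂ] Mat d) (hT : Hyp T) :
    ∃ s ∈ Matrix.unitaryGroup (Fin d) ℂ, ∃ anti : Bool,
      ∀ u ∈ Matrix.unitaryGroup (Fin d) ℂ, ∀ A,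
        T.symm (u * T A * uᴴ) = Sinv s anti (u * Sfwd s anti A * uᴴ) := by
  have hd0 : (d : ℂ) ≠ 0 := by
    have : d ≠ 0 := by omega
    exact_mod_cast this
  obtain ⟨φ, h1, h2⟩ := exists_phi hd T hT
  have hlie := phi_lie hd T φ h1 h2
  have hone := phi_one hd T φ h1 h2
  have htr := phi_trace hd T φ h1 h2
  have hequ := phi_equivariant hd T φ h1 h2
  let z : Fin d := ⟨0, by omega⟩
  have h1' : ∀ A X, T (φ A * X - X * φ A) = A * T X - T X * A := by
    intro A X; rw [← h1]; simp
  have hE : Matrix.single z z (1 : ℂ) * Matrix.single z z 1 = Matrix.single z z 1 := by simp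
  have hq := quad hd (φ (Matrix.single z z 1)) (by rw [h2]; simp) (by rw [htr, hE]; simp) (by
    intro X
    generalize hP : Matrix.single z z (1 : ℂ) = P at hE
    have e1 : P * (P * (P * T X - T X * P) - (P * T X - T X * P) * P)
        - (P * (P * T X - T X * P) - (P * T X - T X * P) * P) * P = P * T X - T X * P := by
      have hE2 : ∀ Y, P * (P * Y) = P * Y := fun Y => by rw [← mul_assoc, hE]
      simp only [mul_sub, sub_mul, mul_assoc, hE, hE2]
      abel
    rw [← h1' P X, ← h1', ← h1'] at e1
    have e2 := T.injective e1
    have e3 : ∀ K : Mat d, K * K * K * X * 1 - (3 : ℂ) • (K * K * X * K)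
        + (3 : ℂ) • (K * X * (K * K)) - 1 * X * (K * K * K)
        = K * (K * (K * X - X * K) - (K * X - X * K) * K)
          - (K * (K * X - X * K) - (K * X - X * K) * K) * K := by
      intro K
      simp only [mul_sub, sub_mul, mul_assoc, one_mul, mul_one]
      module
    rw [e3, e2, mul_one, one_mul])
  rcases hq with hq | hq
  · have hj := jordan z φ (fun A B hAB => by
        have := hlie A B
        rw [hAB, sub_self, map_zero] at this
        exact sub_eq_zero.1 this.symm) htr
      (fun u hu => by
        obtain ⟨v, hv, hA⟩ := hT u hu
        exact ⟨v, hv, hequ u v hu hv hA⟩) hq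
    have hmul : ∀ A B, φ (A * B) = φ A * φ B := by
      intro A B
      have e : A * B = (1 / 2 : ℂ) • ((A * B + B * A) + (A * B - B * A)) := by module
      rw [e, map_smul, map_add, hj, hlie]
      module
    obtain ⟨w, hw, hwA⟩ := hom_unitary hd φ (inj_of_trace φ htr) hone hmul
      (fun u hu => by
        obtain ⟨v, hv, hA⟩ := hT u hu
        exact ⟨v, hv, hequ u v hu hv hA⟩)
    refine ⟨wᴴ, uni_conj hw, false, fun u hu A => ?_⟩
    obtain ⟨v, hv, hA⟩ := hT u hu
    have e := hequ u v hu hv hA (wᴴ * A * w)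
    rw [hwA, hwA] at e
    have e2 : w * (wᴴ * A * w) * wᴴ = A := by
      calc _ = (w * wᴴ) * A * (w * wᴴ) := by simp only [mul_assoc]
        _ = _ := by rw [uni_right hw]; simp
    rw [e2] at e
    rw [hA, ← e]
    simp [Sinv, Sfwd]
  · let ψ : Mat d →ₗ[ℂ] Mat d :=
      ((2 / d : ℂ) • (Matrix.traceLinearMap (Fin d) ℂ ℂ)).smulRight (1 : Mat d) - φ
    have hψ : ∀ A, ψ A = (2 / d * A.trace : ℂ) • (1 : Mat d) - φ A := fun A => by simp [ψ]
    have hψlie : ∀ A B, ψ (A * B - B * A) = ψ B * ψ A - ψ A * ψ B := by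
      intro A B
      rw [hψ, hψ, hψ, hlie, trace_sub, trace_mul_comm A B, sub_self, mul_zero, zero_smul]
      simp only [sub_mul, mul_sub, Matrix.smul_mul, Matrix.mul_smul, one_mul, mul_one]
      module
    have hψtr : ∀ A B, (ψ A * ψ B).trace = (A * B).trace := by
      intro A B
      rw [hψ, hψ]
      simp only [sub_mul, mul_sub, Matrix.smul_mul, Matrix.mul_smul, one_mul, mul_one,
        trace_sub, trace_smul, htr, h2, trace_one, Fintype.card_fin, smul_eq_mul]
      field_simp
      ring
    have hψequ : ∀ u v : Mat d, u ∈ Matrix.unitaryGroup (Fin d) ℂ →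
        v ∈ Matrix.unitaryGroup (Fin d) ℂ → (∀ A, T.symm (u * T A * uᴴ) = v * A * vᴴ) →
        ∀ A, ψ (u * A * uᴴ) = v * ψ A * vᴴ := by
      intro u v hu hv huv A
      rw [hψ, hψ, hequ u v hu hv huv, trace_mul_cycle, uni_left hu, one_mul]
      simp [mul_sub, sub_mul, uni_right hv]
    have hψone : ψ 1 = 1 := by
      rw [hψ, hone, trace_one]
      simp only [Fintype.card_fin]
      rw [div_mul_cancel₀ _ hd0]
      module
    have hj := jordan z ψ (fun A B hAB => by
        have := hψlie A B
        rw [hAB, sub_self, map_zero] at this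
        exact (sub_eq_zero.1 this.symm).symm) hψtr
      (fun u hu => by
        obtain ⟨v, hv, hA⟩ := hT u hu
        exact ⟨v, hv, hψequ u v hu hv hA⟩) (by
        have : ψ (Matrix.single z z 1) = (2 / d : ℂ) • (1 : Mat d) - φ (Matrix.single z z 1) := by
          rw [hψ]; simp
        rw [this, hq])
    have hmul : ∀ A B, ψ (A * B) = ψ B * ψ A := by
      intro A B
      have e : A * B = (1 / 2 : ℂ) • ((A * B + B * A) + (A * B - B * A)) := by module
      rw [e, map_smul, map_add, hj, hψlie]
      module
    let χ : Mat d →ₗ[ℂ] Mat d := ψ ∘ₗ (Matrix.transposeLinearEquiv (Fin d) (Fin d) ℂ ℂ).toLinearMap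
    have hχ : ∀ A, χ A = ψ Aᵀ := fun A => rfl
    have hχequ : ∀ u ∈ Matrix.unitaryGroup (Fin d) ℂ, ∃ v ∈ Matrix.unitaryGroup (Fin d) ℂ,
        ∀ A, χ (u * A * uᴴ) = v * χ A * vᴴ := by
      intro u hu
      have hu' := uni_trans (uni_conj hu)
      obtain ⟨v, hv, hA⟩ := hT _ hu'
      refine ⟨v, hv, fun A => ?_⟩
      rw [hχ, hχ, ← hψequ _ v hu' hv hA]
      congr 1
      rw [hth]
      simp only [transpose_mul, mul_assoc]
    obtain ⟨w, hw, hwA⟩ := hom_unitary hd χ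
      (fun A B hAB => Matrix.transpose_injective (inj_of_trace ψ hψtr hAB))
      (by rw [hχ, transpose_one, hψone])
      (fun A B => by rw [hχ, transpose_mul, hmul, hχ, hχ]) hχequ
    refine ⟨wᵀ, uni_trans hw, true, fun u hu A => ?_⟩
    obtain ⟨v, hv, hA⟩ := hT u hu
    have e := hψequ u v hu hv hA (wᴴ * A * w)ᵀ
    rw [← hχ, hwA] at e
    have e2 : w * (wᴴ * A * w) * wᴴ = A := by
      calc _ = (w * wᴴ) * A * (w * wᴴ) := by simp only [mul_assoc]
        _ = _ := by rw [uni_right hw]; simp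
    rw [e2, ← transpose_transpose (u * (wᴴ * A * w)ᵀ * uᴴ), ← hχ, hwA] at e
    rw [hA, ← e]
    simp only [Sinv, Sfwd, if_true, transpose_mul, transpose_transpose, mul_assoc]
    rfl

/-- Lemma 2, symmetry transformations on unitary maps: for an invertible
linear map `T` on matrices, `T⁻¹∘𝓤∘T ∈ 𝕌` for all `𝓤 ∈ 𝕌` iff there is a unitary or
antiunitary transformation `𝓢 ∈ 𝕊` with `T⁻¹∘𝓤∘T = 𝓢⁻¹∘𝓤∘𝓢` for all `𝓤 ∈ 𝕌`. -/
theorem symmetry_transformations_on_unitary_maps {d : ℕ} (hd : 2 ≤ d)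
    (T : Mat d ≃ₗ[ℂ] Mat d) :
    (∀ U ∈ UniMapSet d, (T.symm.toLinearMap ∘ₗ U ∘ₗ T.toLinearMap) ∈ UniMapSet d) ↔
    (∃ u ∈ Matrix.unitaryGroup (Fin d) ℂ, ∃ anti : Bool,
      ∀ U ∈ UniMapSet d, ∀ A, T.symm (U (T A)) = Sinv u anti (U (Sfwd u anti A))) := by
  constructor
  · intro h
    have hT : Hyp T := by
      intro u hu
      obtain ⟨v, hv, hA⟩ := h (LinearMap.mulLeft ℂ u ∘ₗ LinearMap.mulRight ℂ uᴴ)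
        ⟨u, hu, fun A => by simp [mul_assoc]⟩
      refine ⟨v, hv, fun A => ?_⟩
      rw [← hA]
      simp [mul_assoc]
    obtain ⟨s, hs, anti, hA⟩ := forward hd T hT
    refine ⟨s, hs, anti, ?_⟩
    rintro U ⟨u, hu, hU⟩ A
    rw [hU, hU, hA u hu]
  · rintro ⟨s, hs, anti, h⟩ U hUm
    obtain ⟨u, hu, hU⟩ := hUm
    have hw : sᴴ * u * s ∈ Matrix.unitaryGroup (Fin d) ℂ :=
      mul_mem (mul_mem (uni_conj hs) hu) hs
    cases anti
    · refine ⟨_, hw, fun A => ?_⟩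
      have := h U ⟨u, hu, hU⟩ A
      rw [hU (Sfwd _ _ _)] at this
      simp only [LinearMap.comp_apply, LinearEquiv.coe_coe]
      rw [this]
      simp [Sinv, Sfwd, mul_assoc]
    · refine ⟨_, uni_trans (uni_conj hw), fun A => ?_⟩
      have := h U ⟨u, hu, hU⟩ A
      rw [hU (Sfwd _ _ _)] at this
      simp only [LinearMap.comp_apply, LinearEquiv.coe_coe]
      rw [this]
      have e : ((sᴴ * u * s)ᴴᵀ)ᴴ = (sᴴ * u * s)ᵀ := hth _
      rw [e]
      simp only [Sinv, Sfwd, if_true, transpose_mul, conjTranspose_mul,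
        conjTranspose_conjTranspose, transpose_transpose, mul_assoc]
end
end

section
/- Let d = 2 or d = 3, let T be an invertible linear map on d×d complex matrices, and let 𝓤 ∈ 𝕌. Then 𝓤 ∈ 𝕌 and T⁻¹∘𝓤∘T ∈ 𝕌 hold if and only if there exists a unitary or antiunitary transformation 𝓢 ∈ 𝕊 such that T⁻¹∘𝓤∘T = 𝓢⁻¹∘𝓤∘𝓢. -/
open Matrix

noncomputable section

theorem aux_diag {d : ℕ} (u : Mat d) (hu : u ∈ Matrix.unitaryGroup (Fin d) ℂ) :
    ∃ P ∈ Matrix.unitaryGroup (Fin d) ℂ, ∃ l : Fin d → ℂ, u = P * diagonal l * Pᴴ := by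
  have h1 : u * uᴴ = 1 := Matrix.mem_unitaryGroup_iff.1 hu
  have h2 : uᴴ * u = 1 := Matrix.mem_unitaryGroup_iff'.1 hu
  set A : Mat d := u + uᴴ with hA
  set B : Mat d := Complex.I • (u - uᴴ) with hB
  have hAH : A.IsHermitian := by
    simp [Matrix.IsHermitian, hA, add_comm]
  have hBH : B.IsHermitian := by
    simp only [Matrix.IsHermitian, hB, conjTranspose_smul, conjTranspose_sub, conjTranspose_conjTranspose]
    ext i j; simp; ring
  have hAS := Matrix.isSymmetric_toEuclideanLin_iff.2 hAH
  have hBS := Matrix.isSymmetric_toEuclideanLin_iff.2 hBH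
  have hAB : A * B = B * A := by
    simp [hA, hB, mul_add, add_mul, mul_sub, sub_mul, h1, h2]
    module
  have hcomm : Commute (toEuclideanLin A) (toEuclideanLin B) := by
    apply LinearMap.ext
    intro x
    have := congrArg (fun M : Mat d => WithLp.toLp 2 (M *ᵥ x.ofLp)) hAB
    simpa [Module.End.mul_apply, toLpLin_apply, ← Matrix.mulVec_mulVec] using this
  have hint := hAS.directSum_isInternal_of_commute hBS hcomm
  have hfam := hAS.orthogonalFamily_eigenspace_inf_eigenspace hBS
  classical
  have hint' := DirectSum.isInternal_ne_bot_iff.2 hint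
  have hfin := WellFoundedGT.finite_ne_bot_of_iSupIndep hint.submodule_iSupIndep
  have : Fintype {i : ℂ × ℂ // Module.End.eigenspace (toEuclideanLin A) i.2 ⊓
    Module.End.eigenspace (toEuclideanLin B) i.1 ≠ ⊥} := hfin.fintype
  have hfam' := hfam.comp (Subtype.val_injective (p := fun i : ℂ × ℂ =>
    Module.End.eigenspace (toEuclideanLin A) i.2 ⊓ Module.End.eigenspace (toEuclideanLin B) i.1 ≠ ⊥))
  have hn : Module.finrank ℂ (EuclideanSpace ℂ (Fin d)) = d := by simp
  let b := hint'.subordinateOrthonormalBasis hn hfam'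
  have hb : ∀ i, ∃ m : ℂ, u *ᵥ (b i).ofLp = m • (b i).ofLp := by
    intro i
    have := hint'.subordinateOrthonormalBasis_subordinate hn i hfam'
    obtain ⟨ha, hbb⟩ := this
    have ha := Module.End.mem_eigenspace_iff.1 ha
    have hbb := Module.End.mem_eigenspace_iff.1 hbb
    set c := (hint'.subordinateOrthonormalBasisIndex hn i hfam').1
    refine ⟨(c.2 - Complex.I * c.1) / 2, ?_⟩
    have ha' : A *ᵥ (b i).ofLp = c.2 • (b i).ofLp := by
      simpa [toLpLin_apply] using congrArg WithLp.ofLp ha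
    have hb' : B *ᵥ (b i).ofLp = c.1 • (b i).ofLp := by
      simpa [toLpLin_apply] using congrArg WithLp.ofLp hbb
    have hu : u = (1/2 : ℂ) • (A - Complex.I • B) := by
      ext i j
      simp [hA, hB]
      linear_combination ((1/2 : ℂ) * (u i j - (starRingEnd ℂ) (u j i))) * Complex.I_mul_I
    rw [hu, Matrix.smul_mulVec, Matrix.sub_mulVec, Matrix.smul_mulVec, ha', hb']
    ext k
    simp
    ring
  choose l hl using hb
  let P : Mat d := (EuclideanSpace.basisFun (Fin d) ℂ).toBasis.toMatrix b
  have hP : P ∈ Matrix.unitaryGroup (Fin d) ℂ :=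
    OrthonormalBasis.toMatrix_orthonormalBasis_mem_unitary _ _
  refine ⟨P, hP, l, ?_⟩
  have hPu : u * P = P * diagonal l := by
    ext i j
    have := congrFun (hl j) i
    rw [Matrix.mul_diagonal]
    simpa [Matrix.mul_apply, Matrix.mulVec, dotProduct, P, Module.Basis.toMatrix_apply, mul_comm] using this
  have hP1 : P * Pᴴ = 1 := Matrix.mem_unitaryGroup_iff.1 hP
  rw [← hPu, mul_assoc, hP1, mul_one]

theorem aux_perm {d : ℕ} (f g : Fin d → ℂ)
    (h : (diagonal f).charpoly = (diagonal g).charpoly) : ∃ σ : Equiv.Perm (Fin d), ∀ i, g (σ i) = f i := by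
  rw [charpoly_diagonal, charpoly_diagonal] at h
  have h' := congrArg Polynomial.roots h
  have key : ∀ f : Fin d → ℂ, (∏ i, (Polynomial.X - Polynomial.C (f i))).roots
      = Finset.univ.val.map f := by
    intro f
    have h := Polynomial.roots_multiset_prod_X_sub_C (Finset.univ.val.map f)
    rwa [Multiset.map_map] at h
  rw [key, key] at h'
  have hc : ∀ c : ℂ, Nonempty ({a // f a = c} ≃ {a // g a = c}) := by
    intro c
    have := congrArg (Multiset.count c) h'
    rw [Multiset.count_map, Multiset.count_map] at this
    refine ⟨Fintype.equivOfCardEq ?_⟩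
    rw [Fintype.card_subtype, Fintype.card_subtype]
    simpa [Finset.card, eq_comm] using this
  exact ⟨Equiv.ofFiberEquiv fun c => (hc c).some, fun i => Equiv.ofFiberEquiv_map _ i⟩

theorem aux_charpoly_conj {d : ℕ} (P D : Mat d) (hP : P ∈ Matrix.unitaryGroup (Fin d) ℂ) :
    (P * D * Pᴴ).charpoly = D.charpoly := by
  have h2 : Pᴴ * P = 1 := Matrix.mem_unitaryGroup_iff'.1 hP
  rw [charpoly_mul_comm, ← mul_assoc, h2, one_mul]

theorem aux_sim {d : ℕ} (u v : Mat d) (hu : u ∈ Matrix.unitaryGroup (Fin d) ℂ)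
    (hv : v ∈ Matrix.unitaryGroup (Fin d) ℂ) (h : v.charpoly = u.charpoly) :
    ∃ W ∈ Matrix.unitaryGroup (Fin d) ℂ, v = Wᴴ * u * W := by
  obtain ⟨P, hP, l, rfl⟩ := aux_diag u hu
  obtain ⟨Q, hQ, m, rfl⟩ := aux_diag v hv
  rw [aux_charpoly_conj _ _ hP, aux_charpoly_conj _ _ hQ] at h
  obtain ⟨σ, hσ⟩ := aux_perm _ _ h
  have hP2 : Pᴴ * P = 1 := Matrix.mem_unitaryGroup_iff'.1 hP
  let S : Mat d := σ.permMatrix ℂ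
  have hS1 : S * Sᴴ = 1 := by
    simp [S, conjTranspose_permMatrix, ← Matrix.permMatrix_mul]
  have hSm : diagonal m * S = S * diagonal l := by
    ext i j
    rw [Matrix.diagonal_mul, Matrix.mul_diagonal]
    simp only [S, Equiv.Perm.permMatrix, PEquiv.toMatrix_apply]
    by_cases hij : σ i = j
    · simp [← hij, hσ]
    · simp [hij]
  have hS : S ∈ Matrix.unitaryGroup (Fin d) ℂ := Matrix.mem_unitaryGroup_iff.2 hS1
  have hPs : Pᴴ ∈ Matrix.unitaryGroup (Fin d) ℂ := Unitary.star_mem hP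
  have hSs : Sᴴ ∈ Matrix.unitaryGroup (Fin d) ℂ := Unitary.star_mem hS
  have hQs : Qᴴ ∈ Matrix.unitaryGroup (Fin d) ℂ := Unitary.star_mem hQ
  refine ⟨P * Sᴴ * Qᴴ, mul_mem (mul_mem hP hSs) hQs, ?_⟩
  have : diagonal m = S * diagonal l * Sᴴ := by rw [← hSm, mul_assoc, hS1, mul_one]
  rw [this]
  simp only [conjTranspose_mul, conjTranspose_conjTranspose, mul_assoc]
  simp only [← mul_assoc Pᴴ P, hP2, one_mul]

theorem aux_trace {d : ℕ} (U : Mat d →ₗ[ℂ] Mat d) (u : Mat d) (h : ∀ A, U A = u * A * uᴴ) :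
    LinearMap.trace ℂ _ U = u.trace * star u.trace := by
  rw [LinearMap.trace_eq_matrix_trace ℂ (Matrix.stdBasis ℂ (Fin d) (Fin d))]
  simp only [Matrix.trace, Matrix.diag, LinearMap.toMatrix_apply, Fintype.sum_prod_type, star_sum,
    Finset.sum_mul_sum]
  refine Finset.sum_congr rfl fun i _ => Finset.sum_congr rfl fun j _ => ?_
  rw [h, Matrix.stdBasis_eq_single]
  have : ∀ (M : Mat d), (Matrix.stdBasis ℂ (Fin d) (Fin d)).repr M (i,j) = M i j := by
    intro M; simp [Matrix.stdBasis]
  rw [this]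
  simp [Matrix.mul_apply, Matrix.single_apply, ite_and]

theorem aux_smul_mem {d : ℕ} (u : Mat d) (hu : u ∈ Matrix.unitaryGroup (Fin d) ℂ) (z : ℂ)
    (hz : z * star z = 1) : z • u ∈ Matrix.unitaryGroup (Fin d) ℂ := by
  have h1 : u * uᴴ = 1 := Matrix.mem_unitaryGroup_iff.1 hu
  rw [Matrix.mem_unitaryGroup_iff, Matrix.star_eq_conjTranspose, conjTranspose_smul,
    Matrix.smul_mul, Matrix.mul_smul, h1, smul_smul, hz, one_smul]

theorem aux_conj_mem {d : ℕ} (u : Mat d) (hu : u ∈ Matrix.unitaryGroup (Fin d) ℂ) :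
    uᴴᵀ ∈ Matrix.unitaryGroup (Fin d) ℂ := by
  have h1 : u * uᴴ = 1 := Matrix.mem_unitaryGroup_iff.1 hu
  have h2 : uᴴᵀᴴ = uᵀ := by ext i j; simp
  rw [Matrix.mem_unitaryGroup_iff, Matrix.star_eq_conjTranspose, h2, ← Matrix.transpose_mul, h1,
    Matrix.transpose_one]

theorem aux_adj {d : ℕ} (u : Mat d) (hu : u ∈ Matrix.unitaryGroup (Fin d) ℂ) (h : u.det = 1) :
    u.adjugate = uᴴ := by
  have h2 : uᴴ * u = 1 := Matrix.mem_unitaryGroup_iff'.1 hu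
  have h3 := Matrix.mul_adjugate u
  rw [h, one_smul] at h3
  calc u.adjugate = uᴴ * u * u.adjugate := by rw [h2, one_mul]
    _ = uᴴ := by rw [mul_assoc, h3, mul_one]

theorem aux_charpoly3 (M : Mat 3) : M.charpoly = Polynomial.X ^ 3 - Polynomial.C M.trace * Polynomial.X ^ 2
    + Polynomial.C M.adjugate.trace * Polynomial.X - Polynomial.C M.det := by
  rw [Matrix.charpoly, Matrix.det_fin_three, Matrix.adjugate_fin_three, Matrix.det_fin_three]
  simp [charmatrix_apply, Matrix.trace_fin_three]
  ring

theorem aux_trace_sq3 (M : Mat 3) : (M * M).trace = M.trace ^ 2 - 2 * M.adjugate.trace := by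
  rw [Matrix.adjugate_fin_three]
  simp [Matrix.trace_fin_three, Matrix.mul_apply, Fin.sum_univ_three]
  ring

theorem aux_phase {d : ℕ} (hd : d ≠ 0) (u : Mat d) (hu : u ∈ Matrix.unitaryGroup (Fin d) ℂ) :
    ∃ z : ℂ, z * star z = 1 ∧ (z • u).det = 1 := by
  have hdet := (Matrix.det_of_mem_unitary hu).2
  obtain ⟨z, hz⟩ := IsAlgClosed.exists_pow_nat_eq (star u.det) (Nat.pos_of_ne_zero hd)
  refine ⟨z, ?_, ?_⟩
  · have h1 : ‖u.det‖ = 1 := by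
      have := congrArg norm hdet
      rw [norm_mul, norm_star, norm_one] at this
      nlinarith [norm_nonneg u.det]
    have h2 : ‖z‖ ^ d = 1 := by rw [← norm_pow, hz, norm_star, h1]
    have h3 : ‖z‖ = 1 := (pow_eq_one_iff_of_nonneg (norm_nonneg _) hd).1 h2
    rw [Complex.star_def, Complex.mul_conj, Complex.normSq_eq_norm_sq, h3]; simp
  · rw [Matrix.det_smul, Fintype.card_fin, hz]
    exact Unitary.star_mul_self_of_mem (Matrix.det_of_mem_unitary hu)

theorem aux_cube (s t : ℂ) (h : s ^ 3 = t ^ 3) : ∃ w : ℂ, w ^ 3 = 1 ∧ s = w * t := by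
  by_cases ht : t = 0
  · subst ht
    have : s = 0 := by simpa using h
    exact ⟨1, by simp, by simp [this]⟩
  · exact ⟨s / t, by rw [div_pow, h, div_self (pow_ne_zero _ ht)], by field_simp⟩

theorem aux_unit_of_pow (w : ℂ) (n : ℕ) (hn : n ≠ 0) (h : w ^ n = 1) : w * star w = 1 := by
  have h3 : ‖w‖ = 1 := by
    have := congrArg norm h
    rw [norm_pow, norm_one] at this
    exact (pow_eq_one_iff_of_nonneg (norm_nonneg _) hn).1 this
  rw [Complex.star_def, Complex.mul_conj, Complex.normSq_eq_norm_sq, h3]; simp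

theorem aux_char_eq3 (u v : Mat 3) (hu : u ∈ Matrix.unitaryGroup (Fin 3) ℂ)
    (hv : v ∈ Matrix.unitaryGroup (Fin 3) ℂ) (hu1 : u.det = 1) (hv1 : v.det = 1)
    (w : ℂ) (hw : w ^ 3 = 1) (h : v.trace = w * u.trace) : v.charpoly = (w • u).charpoly := by
  have hw' := aux_unit_of_pow w 3 (by norm_num) hw
  have hwu := aux_smul_mem u hu w hw'
  have hd : (w • u).det = 1 := by rw [Matrix.det_smul, Fintype.card_fin, hw, hu1, one_mul]
  have ht : v.trace = (w • u).trace := by rw [h, Matrix.trace_smul, smul_eq_mul]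
  rw [aux_charpoly3, aux_charpoly3, aux_adj v hv hv1, aux_adj _ hwu hd, hd, hv1,
    trace_conjTranspose, trace_conjTranspose, ht]

/-- The `SU(3)` case. -/
theorem aux_main3 (u v : Mat 3) (hu : u ∈ Matrix.unitaryGroup (Fin 3) ℂ)
    (hv : v ∈ Matrix.unitaryGroup (Fin 3) ℂ) (hu1 : u.det = 1) (hv1 : v.det = 1)
    (h1 : v.trace * star v.trace = u.trace * star u.trace)
    (h2 : (v * v).trace * star (v * v).trace = (u * u).trace * star (u * u).trace) :
    ∃ w : ℂ, w * star w = 1 ∧ (v.charpoly = (w • u).charpoly ∨ v.charpoly = (w • uᴴᵀ).charpoly) := by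
  rw [aux_trace_sq3, aux_trace_sq3, aux_adj v hv hv1, aux_adj u hu hu1, trace_conjTranspose,
    trace_conjTranspose] at h2
  set t := u.trace with ht
  set s := v.trace with hs
  simp only [star_sub, star_mul, star_pow, Complex.star_def, map_ofNat, Complex.conj_conj] at h1 h2
  have h3 : s ^ 3 + (starRingEnd ℂ s) ^ 3 = t ^ 3 + (starRingEnd ℂ t) ^ 3 := by
    linear_combination (-1/2 : ℂ) * h2 + (2 + (s * starRingEnd ℂ s + t * starRingEnd ℂ t) / 2) * h1
  have h4 : s ^ 3 * (starRingEnd ℂ s) ^ 3 = t ^ 3 * (starRingEnd ℂ t) ^ 3 := by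
    rw [← mul_pow, ← mul_pow, h1]
  have h5 : (s ^ 3 - t ^ 3) * (s ^ 3 - (starRingEnd ℂ t) ^ 3) = 0 := by
    linear_combination s ^ 3 * h3 - h4
  rcases mul_eq_zero.1 h5 with h | h
  · obtain ⟨w, hw, hst⟩ := aux_cube _ _ (sub_eq_zero.1 h)
    exact ⟨w, aux_unit_of_pow w 3 (by norm_num) hw, Or.inl (aux_char_eq3 u v hu hv hu1 hv1 w hw hst)⟩
  · obtain ⟨w, hw, hst⟩ := aux_cube _ _ (sub_eq_zero.1 h)
    refine ⟨w, aux_unit_of_pow w 3 (by norm_num) hw, Or.inr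
      (aux_char_eq3 uᴴᵀ v (aux_conj_mem u hu) hv ?_ hv1 w hw ?_)⟩
    · rw [det_transpose, det_conjTranspose, hu1, star_one]
    · rw [trace_transpose, trace_conjTranspose]; exact hst

/-- The `SU(2)` case. -/
theorem aux_main2 (u v : Mat 2) (hu : u ∈ Matrix.unitaryGroup (Fin 2) ℂ)
    (hv : v ∈ Matrix.unitaryGroup (Fin 2) ℂ) (hu1 : u.det = 1) (hv1 : v.det = 1)
    (h1 : v.trace * star v.trace = u.trace * star u.trace) :
    ∃ w : ℂ, w * star w = 1 ∧ (v.charpoly = (w • u).charpoly ∨ v.charpoly = (w • uᴴᵀ).charpoly) := by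
  have key : ∀ M : Mat 2, M ∈ Matrix.unitaryGroup (Fin 2) ℂ → M.det = 1 → star M.trace = M.trace := by
    intro M hM hM1
    rw [← trace_conjTranspose, ← aux_adj M hM hM1, Matrix.adjugate_fin_two]
    simp [Matrix.trace_fin_two, add_comm]
  rw [key u hu hu1, key v hv hv1] at h1
  rcases mul_self_eq_mul_self_iff.1 h1 with h | h
  · refine ⟨1, by simp, Or.inl ?_⟩
    rw [one_smul, charpoly_fin_two, charpoly_fin_two, h, hu1, hv1]
  · refine ⟨-1, by simp, Or.inl ?_⟩
    rw [charpoly_fin_two, charpoly_fin_two, h, det_smul, trace_smul, hu1, hv1]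
    simp

theorem aux_final {d : ℕ} (hd : d = 2 ∨ d = 3) (u v : Mat d)
    (hu : u ∈ Matrix.unitaryGroup (Fin d) ℂ) (hv : v ∈ Matrix.unitaryGroup (Fin d) ℂ)
    (h1 : v.trace * star v.trace = u.trace * star u.trace)
    (h2 : (v * v).trace * star (v * v).trace = (u * u).trace * star (u * u).trace) :
    ∃ z : ℂ, z * star z = 1 ∧ ∃ W ∈ Matrix.unitaryGroup (Fin d) ℂ,
      v = z • (Wᴴ * u * W) ∨ v = z • (Wᴴ * uᴴᵀ * W) := by
  have hd0 : d ≠ 0 := by omega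
  obtain ⟨a, ha, hau⟩ := aux_phase hd0 u hu
  obtain ⟨b, hb, hbv⟩ := aux_phase hd0 v hv
  have hu' := aux_smul_mem u hu a ha
  have hv' := aux_smul_mem v hv b hb
  have h1' : (b • v).trace * star (b • v).trace = (a • u).trace * star (a • u).trace := by
    simp only [trace_smul, smul_eq_mul, star_mul]
    linear_combination h1 + v.trace * star v.trace * hb - u.trace * star u.trace * ha
  have h2' : ((b • v) * (b • v)).trace * star ((b • v) * (b • v)).trace
      = ((a • u) * (a • u)).trace * star ((a • u) * (a • u)).trace := by
    simp only [Matrix.smul_mul, Matrix.mul_smul, trace_smul, smul_eq_mul, star_mul]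
    linear_combination h2 + (v * v).trace * star (v * v).trace * (b * star b + 1) * hb
      - (u * u).trace * star (u * u).trace * (a * star a + 1) * ha
  have hmain : ∃ w : ℂ, w * star w = 1 ∧ ((b • v).charpoly = (w • (a • u)).charpoly ∨
      (b • v).charpoly = (w • (a • u)ᴴᵀ).charpoly) := by
    rcases hd with rfl | rfl
    · exact aux_main2 _ _ hu' hv' hau hbv h1'
    · exact aux_main3 _ _ hu' hv' hau hbv h1' h2'
  obtain ⟨w, hw, hc⟩ := hmain
  have hvb : v = star b • (b • v) := by rw [smul_smul, mul_comm, hb, one_smul]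
  rcases hc with hc | hc
  · obtain ⟨W, hW, hE⟩ := aux_sim _ _ (aux_smul_mem _ hu' w hw) hv' hc
    refine ⟨star b * w * a, ?_, W, hW, Or.inl ?_⟩
    · simp only [star_mul, star_star]
      linear_combination (w * star w * a * star a) * hb + a * star a * hw + ha
    · rw [hvb, hE]
      simp only [Matrix.smul_mul, Matrix.mul_smul, smul_smul]
      congr 1; ring
  · obtain ⟨W, hW, hE⟩ := aux_sim _ _ (aux_smul_mem _ (aux_conj_mem _ hu') w hw) hv' hc
    refine ⟨star b * w * star a, ?_, W, hW, Or.inr ?_⟩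
    · simp only [star_mul, star_star]
      linear_combination (w * star w * a * star a) * hb + a * star a * hw + ha
    · rw [hvb, hE]
      simp only [conjTranspose_smul, transpose_smul, Matrix.smul_mul, Matrix.mul_smul, smul_smul]
      congr 1; ring

/-- Lemma A1: for `d = 2` or `d = 3`, an invertible linear map `T` and
`𝓤 ∈ 𝕌`, one has `𝓤 ∈ 𝕌` and `T⁻¹∘𝓤∘T ∈ 𝕌` iff there is a unitary or antiunitary
transformation `𝓢 ∈ 𝕊` with `T⁻¹∘𝓤∘T = 𝓢⁻¹∘𝓤∘𝓢`. -/
theorem dim_two_three_unitary_conjugation {d : ℕ} (hd : d = 2 ∨ d = 3)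
    (T : Mat d ≃ₗ[ℂ] Mat d) (U : Mat d →ₗ[ℂ] Mat d) (hU : U ∈ UniMapSet d) :
    (U ∈ UniMapSet d ∧ (T.symm.toLinearMap ∘ₗ U ∘ₗ T.toLinearMap) ∈ UniMapSet d) ↔
    (∃ u ∈ Matrix.unitaryGroup (Fin d) ℂ, ∃ anti : Bool,
      ∀ A, T.symm (U (T A)) = Sinv u anti (U (Sfwd u anti A))) := by
  constructor
  · rintro ⟨-, v, hv, hV⟩
    obtain ⟨u, hu, hU⟩ := hU
    set V : Mat d →ₗ[ℂ] Mat d := T.symm.toLinearMap ∘ₗ U ∘ₗ T.toLinearMap with hVdef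
    have hconj : ∀ F : Mat d →ₗ[ℂ] Mat d, LinearMap.trace ℂ _
        (T.symm.toLinearMap ∘ₗ F ∘ₗ T.toLinearMap) = LinearMap.trace ℂ _ F := by
      intro F
      rw [← LinearMap.trace_conj' F T.symm]
      rfl
    have h1 : v.trace * star v.trace = u.trace * star u.trace := by
      rw [← aux_trace V v hV, ← aux_trace U u hU, hVdef, hconj]
    have h2 : (v * v).trace * star (v * v).trace = (u * u).trace * star (u * u).trace := by
      rw [← aux_trace (V ∘ₗ V) (v * v), ← aux_trace (U ∘ₗ U) (u * u), ← hconj (U ∘ₗ U)]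
      · congr 1
        ext1 A
        simp [hVdef]
      · intro A; simp [hU, mul_assoc]
      · intro A; simp only [LinearMap.comp_apply, hV, conjTranspose_mul, mul_assoc]
    have hVA : ∀ A, T.symm (U (T A)) = v * A * vᴴ := hV
    obtain ⟨z, hz, W, hW, h | h⟩ := aux_final hd u v hu hv h1 h2
    · refine ⟨W, hW, false, fun A => ?_⟩
      rw [hVA, h]
      simp only [Sinv, Sfwd, hU, conjTranspose_smul, Matrix.smul_mul, Matrix.mul_smul, smul_smul]
      rw [mul_comm, hz]
      simp [mul_assoc]
    · refine ⟨Wᴴᵀ, aux_conj_mem W hW, true, fun A => ?_⟩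
      rw [hVA, h]
      have e : ∀ M : Mat d, Mᴴᵀᴴ = Mᵀ := fun M => by ext i j; simp
      have e' : ∀ M : Mat d, Mᵀᴴ = Mᴴᵀ := fun M => by ext i j; simp
      simp only [Sinv, Sfwd, hU, conjTranspose_smul, Matrix.smul_mul, Matrix.mul_smul, smul_smul]
      rw [mul_comm, hz]
      simp [mul_assoc, e, e', transpose_mul]
  · rintro ⟨w, hw, anti, h⟩
    refine ⟨hU, ?_⟩
    obtain ⟨u, hu, hU⟩ := hU
    have hws : wᴴ ∈ Matrix.unitaryGroup (Fin d) ℂ := Unitary.star_mem hw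
    have hm : wᴴ * u * w ∈ Matrix.unitaryGroup (Fin d) ℂ := mul_mem (mul_mem hws hu) hw
    cases anti
    · refine ⟨wᴴ * u * w, hm, fun A => ?_⟩
      change T.symm (U (T A)) = _
      rw [h]
      simp [Sinv, Sfwd, hU, mul_assoc]
    · refine ⟨(wᴴ * u * w)ᴴᵀ, aux_conj_mem _ hm, fun A => ?_⟩
      change T.symm (U (T A)) = _
      have e : ∀ M : Mat d, Mᴴᵀᴴ = Mᵀ := fun M => by ext i j; simp
      rw [h, e]
      simp [Sinv, Sfwd, hU, mul_assoc, transpose_mul]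
end
end

section
/- Let 𝓤 ∈ 𝕌 be a super-non-degenerate unitary map on d×d complex matrices and let T be an invertible linear map on matrices. Then T⁻¹∘𝓤∘T ∈ 𝕌 if and only if there exists a unitary or antiunitary transformation 𝓢 ∈ 𝕊 such that T⁻¹∘𝓤∘T = 𝓢⁻¹∘𝓤∘𝓢. -/
open Matrix

noncomputable section

/-- The super-non-degeneracy condition on a family of eigenphases `θ`: for all indices
`c ≠ d'`, `e ≠ f`, `c ≠ f`, `d' ≠ e`, the product `e^{i(θ_c−θ_{d'})}·e^{i(θ_e−θ_f)}`
is not of the form `e^{i(θ_a−θ_b)}`. -/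
def SuperNonDegPhases {d : ℕ} (θ : Fin d → ℝ) : Prop :=
  ∀ c d' e f : Fin d, c ≠ d' → e ≠ f → c ≠ f → d' ≠ e →
    ∀ a b : Fin d,
      Complex.exp (((θ c - θ d' : ℝ) : ℂ) * Complex.I) *
          Complex.exp (((θ e - θ f : ℝ) : ℂ) * Complex.I) ≠
        Complex.exp (((θ a - θ b : ℝ) : ℂ) * Complex.I)

/-- A unitary matrix is super-non-degenerate if its eigenvalues, listed with
multiplicity as `e^{iθ_a}`, satisfy the super-non-degeneracy condition. -/
def IsSuperNonDeg {d : ℕ} (u : Matrix (Fin d) (Fin d) ℂ) : Prop :=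
  ∃ θ : Fin d → ℝ, ∃ v ∈ Matrix.unitaryGroup (Fin d) ℂ,
    u = v * Matrix.diagonal (fun a => Complex.exp (((θ a : ℝ) : ℂ) * Complex.I)) * vᴴ ∧
    SuperNonDegPhases θ

section helpers

open scoped Matrix.Norms.L2Operator in
/-- Unitary matrices are unitarily diagonalizable. -/
lemma unitary_diag {d : ℕ} (u : Mat d) (hu : u ∈ Matrix.unitaryGroup (Fin d) ℂ) :
    ∃ θ : Fin d → ℝ, ∃ v ∈ Matrix.unitaryGroup (Fin d) ℂ,
      u = v * Matrix.diagonal (fun a => Complex.exp (((θ a : ℝ) : ℂ) * Complex.I)) * vᴴ := by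
  have hu' : u ∈ unitary (Mat d) := hu
  have : IsStarNormal u := ⟨by
    rw [commute_iff_eq, (Unitary.mem_iff.1 hu').1, (Unitary.mem_iff.1 hu').2]⟩
  have hfin : (spectrum ℂ u).Finite := Matrix.finite_spectrum u
  have hcont : ContinuousOn (fun z : ℂ => (Complex.arg z : ℂ)) (spectrum ℂ u) := hfin.continuousOn _
  set h : Mat d := cfc (fun z : ℂ => (Complex.arg z : ℂ)) u with hh
  have hsa : IsSelfAdjoint h := .cfc_arg u
  have hexp : NormedSpace.exp (Complex.I • h) = u := by
    rw [← CFC.exp_eq_normedSpace_exp (𝕜 := ℂ),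
    ← cfc_comp_smul .., hh, ← cfc_comp' ..]
    conv_rhs => rw [← cfc_id' ℂ u]
    refine cfc_congr fun y hy ↦ ?_
    have hy₁ : ‖y‖ = 1 := spectrum.norm_eq_one_of_unitary hu' hy
    have : Complex.I * y.arg = Complex.log y :=
      Complex.ext (by simp [Complex.log_re, hy₁]) (by simp [Complex.log_im])
    simpa [← Complex.exp_eq_exp_ℂ, this] using Complex.exp_log (by
      intro h0; simp [h0] at hy₁)
  have hH : h.IsHermitian := hsa
  refine ⟨hH.eigenvalues, hH.eigenvectorUnitary.1, hH.eigenvectorUnitary.2, ?_⟩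
  have hV := hH.eigenvectorUnitary.2
  set V : Mat d := hH.eigenvectorUnitary.1 with hVd
  have h1 : V * Vᴴ = 1 := (Unitary.mem_iff.1 hV).2
  have hinv : V⁻¹ = Vᴴ := Matrix.inv_eq_right_inv h1
  have hsp : h = V * Matrix.diagonal (fun a => ((hH.eigenvalues a : ℝ) : ℂ)) * Vᴴ := by
    have := hH.spectral_theorem
    rw [Unitary.conjStarAlgAut_apply] at this
    exact this
  have : Complex.I • h = V * (Complex.I • Matrix.diagonal (fun a => ((hH.eigenvalues a : ℝ) : ℂ))) * V⁻¹ := by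
    rw [hinv, Matrix.mul_smul, Matrix.smul_mul, ← hsp]
  rw [← hexp, this, Matrix.exp_conj _ _ (IsUnit.of_mul_eq_one _ h1), hinv, ← Matrix.diagonal_smul,
    Matrix.exp_diagonal]
  congr 3
  funext a
  simp [Pi.coe_exp, Complex.exp_eq_exp_ℂ, mul_comm]

lemma comb {d : ℕ} (hd : 2 ≤ d) (z z' : Fin d → ℂ)
    (hz : ∀ a, z a * star (z a) = 1) (hz' : ∀ a, z' a * star (z' a) = 1)
    (snd : ∀ c d' e f : Fin d, c ≠ d' → e ≠ f → c ≠ f → d' ≠ e → ∀ a b,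
      z c * star (z d') * (z e * star (z f)) ≠ z a * star (z b))
    (hr : ∀ a b, ∃ c e, z' a * star (z' b) = z c * star (z e))
    (hinj : ∀ a b, a ≠ b → z' a ≠ z' b) :
    ∃ σ : Equiv.Perm (Fin d), ∃ l : ℂ, l * star l = 1 ∧
      ((∀ a, z' a = l * z (σ a)) ∨ (∀ a, z' a = l * star (z (σ a)))) := by
  let o : Fin d := ⟨0, by omega⟩
  let a₁ : Fin d := ⟨1, by omega⟩
  have ho : a₁ ≠ o := by simp [o, a₁]
  choose p q hpq using hr o
  have hs : ∀ a, star (z' o) * z' a = star (z (p a)) * z (q a) := by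
    intro a
    have := congrArg star (hpq a)
    simpa [mul_comm] using this
  have key : ∀ a, z' a = z' o * (star (z (p a)) * z (q a)) := by
    intro a
    linear_combination z' o * hs a - z' a * hz' o
  have hne : ∀ a, a ≠ o → p a ≠ q a := by
    intro a ha he
    apply hinj a o ha
    have h1 := key a
    rw [he] at h1
    linear_combination h1 + z' o * hz (q a)
  have hI : ∀ a b, p a = p b → q a = q b → a = b := by
    intro a b h1 h2
    by_contra hab
    apply hinj a b hab
    rw [key a, key b, h1, h2]
  have share : ∀ a b, a ≠ o → b ≠ o → p a = p b ∨ q a = q b := by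
    intro a b ha hb
    by_contra! hc
    obtain ⟨c, e, hce⟩ := hr a b
    apply snd (q a) (p a) (p b) (q b) (hne a ha).symm (hne b hb) hc.2 hc.1 c e
    rw [← hce]
    linear_combination (z' a * star (z' b)) * hz' o - (star (z' b) * z' o) * hs a - (star (z (p a)) * z (q a)) * hpq b
  have dich : (∀ a b, a ≠ o → b ≠ o → p a = p b) ∨ (∀ a b, a ≠ o → b ≠ o → q a = q b) := by
    by_cases h : ∀ a b, a ≠ o → b ≠ o → p a = p b
    · exact Or.inl h
    · right
      push Not at h
      obtain ⟨a, b, ha, hb, hab⟩ := h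
      have hq := (share a b ha hb).resolve_left hab
      have : ∀ c, c ≠ o → q c = q a := by
        intro c hc
        by_contra hcq
        have h1 := (share c a hc ha).resolve_right hcq
        have h2 := (share c b hc hb).resolve_right (by rw [← hq]; exact hcq)
        exact hab (h1.symm.trans h2)
      intro c e hc he
      rw [this c hc, this e he]
  have star1 : ∀ x y : ℂ, x * star x = 1 → y * star y = 1 → (x * y) * star (x * y) = 1 := by
    intro x y hx hy
    rw [star_mul]
    linear_combination (y * star y) * hx + hy
  have star2 : ∀ x : ℂ, x * star x = 1 → star x * star (star x) = 1 := by
    intro x hx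
    rw [star_star, mul_comm]; exact hx
  rcases dich with hp | hq
  · let s : Fin d → Fin d := fun a => if a = o then p a₁ else q a
    have hsinj : Function.Injective s := by
      intro a b hab
      by_cases ha : a = o <;> by_cases hb : b = o
      · rw [ha, hb]
      · simp only [s, ha, hb, if_true, if_false] at hab
        exact absurd ((hp b a₁ hb ho).trans hab) (hne b hb)
      · simp only [s, ha, hb, if_true, if_false] at hab
        exact absurd ((hp a a₁ ha ho).trans hab.symm) (hne a ha)
      · simp only [s, ha, hb, if_false] at hab
        exact hI a b (hp a b ha hb) hab
    refine ⟨Equiv.ofBijective s (Finite.injective_iff_bijective.1 hsinj), z' o * star (z (p a₁)),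
      star1 _ _ (hz' o) (star2 _ (hz _)), Or.inl ?_⟩
    intro a
    simp only [Equiv.ofBijective_apply, s]
    split_ifs with ha
    · rw [ha]; linear_combination (-z' o) * hz (p a₁)
    · rw [key a, hp a a₁ ha ho]; ring
  · let s : Fin d → Fin d := fun a => if a = o then q a₁ else p a
    have hsinj : Function.Injective s := by
      intro a b hab
      by_cases ha : a = o <;> by_cases hb : b = o
      · rw [ha, hb]
      · simp only [s, ha, hb, if_true, if_false] at hab
        exact absurd ((hq b a₁ hb ho).trans hab).symm (hne b hb)
      · simp only [s, ha, hb, if_true, if_false] at hab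
        exact absurd ((hq a a₁ ha ho).trans hab.symm).symm (hne a ha)
      · simp only [s, ha, hb, if_false] at hab
        exact hI a b hab (hq a b ha hb)
    refine ⟨Equiv.ofBijective s (Finite.injective_iff_bijective.1 hsinj), z' o * z (q a₁),
      star1 _ _ (hz' o) (hz _), Or.inr ?_⟩
    intro a
    simp only [Equiv.ofBijective_apply, s]
    split_ifs with ha
    · rw [ha]; linear_combination (-z' o) * hz (q a₁)
    · rw [key a, hq a a₁ ha ho]; ring

/-- Spectral consequences of an injective intertwiner. -/
lemma inter_spec {d : ℕ} (z z' : Fin d → ℂ)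
    (hz : ∀ a, z a * star (z a) = 1) (hz' : ∀ a, z' a * star (z' a) = 1)
    (hdist : ∀ a b, a ≠ b → z a ≠ z b)
    (L : Mat d →ₗ[ℂ] Mat d) (hL : Function.Injective L)
    (hint : ∀ A i j, z i * star (z j) * L A i j =
      L (Matrix.diagonal z' * A * (Matrix.diagonal z')ᴴ) i j) :
    (∀ a b, ∃ c e, z' a * star (z' b) = z c * star (z e)) ∧
      (∀ a b, a ≠ b → z' a ≠ z' b) := by
  have hE : ∀ a b, Matrix.diagonal z' * Matrix.single a b (1 : ℂ) * (Matrix.diagonal z')ᴴ =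
      (z' a * star (z' b)) • Matrix.single a b (1 : ℂ) := by
    intro a b
    ext i j
    rw [Matrix.diagonal_conjTranspose, Matrix.mul_diagonal, Matrix.diagonal_mul]
    simp only [Matrix.smul_apply, Matrix.single_apply, smul_eq_mul, Pi.star_apply]
    split_ifs with h
    · rw [h.1, h.2]; ring
    · simp
  have hE2 : ∀ a b i j, z i * star (z j) * L (Matrix.single a b 1) i j =
      z' a * star (z' b) * L (Matrix.single a b 1) i j := by
    intro a b i j
    rw [hint, hE, map_smul]; rfl
  constructor
  · intro a b
    have hne : L (Matrix.single a b 1) ≠ 0 := by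
      intro h0
      have := hL (h0.trans (map_zero L).symm)
      have := congrFun (congrFun this a) b
      simp at this
    by_contra! hc
    apply hne
    ext i j
    by_contra h
    exact hc i j (mul_right_cancel₀ h (hE2 a b i j)).symm
  · intro a b hab hzab
    have hdiag : ∀ a b, z' a = z' b → ∀ i j, i ≠ j → L (Matrix.single a b 1) i j = 0 := by
      intro a b he i j hij
      by_contra h
      have h1 := mul_right_cancel₀ h (hE2 a b i j)
      rw [he, hz'] at h1
      apply hdist i j hij
      linear_combination z j * h1 - z i * hz j
    let F : (Option (Fin d) → ℂ) →ₗ[ℂ] Mat d :=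
      { toFun := fun x => Matrix.diagonal (fun i => x (some i)) + x none • Matrix.single a b 1
        map_add' := by
          intro x y
          ext i j
          simp only [Matrix.add_apply, Matrix.diagonal_apply, Pi.add_apply, Matrix.smul_apply, smul_eq_mul]
          split_ifs <;> ring
        map_smul' := by
          intro c x
          ext i j
          simp only [Matrix.add_apply, Matrix.diagonal_apply, Pi.smul_apply, Matrix.smul_apply, smul_eq_mul, RingHom.id_apply]
          split_ifs <;> ring }
    have hFd : ∀ x i j, i ≠ j → L (F x) i j = 0 := by
      intro x i j hij
      have : F x = (∑ k, x (some k) • Matrix.single k k (1:ℂ)) + x none • Matrix.single a b 1 := by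
        change Matrix.diagonal (fun i => x (some i)) + x none • Matrix.single a b (1:ℂ) = _
        congr 1
        rw [← Matrix.sum_single_eq_diagonal]
        simp
      rw [this, map_add, map_sum]
      simp only [map_smul, Matrix.add_apply, Matrix.sum_apply, Matrix.smul_apply,
        hdiag a b hzab i j hij, hdiag _ _ rfl i j hij]
      simp
    let G : (Option (Fin d) → ℂ) →ₗ[ℂ] (Fin d → ℂ) :=
      (Matrix.diagLinearMap (Fin d) ℂ ℂ) ∘ₗ L ∘ₗ F
    have hG : Function.Injective G := by
      rw [injective_iff_map_eq_zero]
      intro x hx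
      have hLx : L (F x) = 0 := by
        ext i j
        by_cases hij : i = j
        · subst hij
          exact congrFun hx i
        · exact hFd x i j hij
      have hFx : F x = 0 := hL (hLx.trans (map_zero L).symm)
      have hent : ∀ i j, F x i j = 0 := fun i j => by rw [hFx]; rfl
      funext k
      cases k with
      | none =>
        have := hent a b
        simpa [F, hab, Matrix.diagonal_apply] using this
      | some i =>
        have := hent i i
        have hn : ¬ (a = i ∧ b = i) := fun h => hab (h.1.trans h.2.symm)
        simpa [F, Matrix.single_apply, hn] using this
    have := LinearMap.finrank_le_finrank_of_injective hG
    simp at this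

lemma conj_perm {d : ℕ} (z : Fin d → ℂ) (v : Mat d) (hv : v ∈ Matrix.unitaryGroup (Fin d) ℂ)
    (σ : Equiv.Perm (Fin d)) : ∃ v₂ ∈ Matrix.unitaryGroup (Fin d) ℂ,
      v * Matrix.diagonal z * vᴴ = v₂ * Matrix.diagonal (fun a => z (σ a)) * v₂ᴴ := by
  refine ⟨v.submatrix id σ, ?_, ?_⟩
  · rw [Matrix.mem_unitaryGroup_iff] at hv ⊢
    rw [Matrix.star_eq_conjTranspose] at hv ⊢
    rw [Matrix.conjTranspose_submatrix, Matrix.submatrix_mul_equiv, hv]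
    simp
  · have : Matrix.diagonal (fun a => z (σ a)) = (Matrix.diagonal z).submatrix σ σ := by
      rw [Matrix.submatrix_diagonal_equiv]; rfl
    rw [this, Matrix.conjTranspose_submatrix, Matrix.submatrix_mul_equiv, Matrix.submatrix_mul_equiv]
    simp

lemma Sconj {d : ℕ} (w u A : Mat d) (anti : Bool) :
    Sinv w anti (u * Sfwd w anti A * uᴴ) =
      (if anti then (wᴴ * uᴴ * w)ᵀ else wᴴ * u * w) * A *
      (if anti then (wᴴ * uᴴ * w)ᵀ else wᴴ * u * w)ᴴ := by
  cases anti
  · simp [Sinv, Sfwd, Matrix.conjTranspose_mul, Matrix.mul_assoc]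
  · have : ∀ B : Mat d, Bᵀᴴ = Bᴴᵀ := fun B => rfl
    simp [Sinv, Sfwd, this, Matrix.conjTranspose_mul, Matrix.transpose_mul, Matrix.mul_assoc]

end helpers

/-- Lemma A2: for a super-non-degenerate unitary map `𝓤 ∈ 𝕌` and an
invertible linear map `T`, `T⁻¹∘𝓤∘T ∈ 𝕌` iff there is a unitary or antiunitary
transformation `𝓢 ∈ 𝕊` with `T⁻¹∘𝓤∘T = 𝓢⁻¹∘𝓤∘𝓢`. -/
theorem super_non_degenerate_unitary_conjugation {d : ℕ} (hd : 2 ≤ d)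
    (u : Mat d) (hu : u ∈ Matrix.unitaryGroup (Fin d) ℂ) (hsnd : IsSuperNonDeg u)
    (U : Mat d →ₗ[ℂ] Mat d) (hUdef : ∀ A, U A = u * A * uᴴ)
    (T : Mat d ≃ₗ[ℂ] Mat d) :
    ((T.symm.toLinearMap ∘ₗ U ∘ₗ T.toLinearMap) ∈ UniMapSet d) ↔
    (∃ w ∈ Matrix.unitaryGroup (Fin d) ℂ, ∃ anti : Bool,
      ∀ A, T.symm (U (T A)) = Sinv w anti (U (Sfwd w anti A))) := by
  constructor
  · rintro ⟨u', hu', hU'⟩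
    obtain ⟨θ, v, hv, huv, hS⟩ := hsnd
    obtain ⟨θ', v', hv', huv'⟩ := unitary_diag u' hu'
    have hunit : ∀ t : ℝ, Complex.exp ((t : ℂ) * Complex.I) *
        star (Complex.exp ((t : ℂ) * Complex.I)) = 1 := by
      intro t
      have : star (Complex.exp ((t : ℂ) * Complex.I)) = Complex.exp (-((t : ℂ) * Complex.I)) := by
        rw [Complex.star_def, ← Complex.exp_conj]; simp
      rw [this, ← Complex.exp_add]; simp
    have hratio : ∀ s t : ℝ, Complex.exp (((s - t : ℝ) : ℂ) * Complex.I) =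
        Complex.exp ((s : ℂ) * Complex.I) * star (Complex.exp ((t : ℂ) * Complex.I)) := by
      intro s t
      have : star (Complex.exp ((t : ℂ) * Complex.I)) = Complex.exp (-((t : ℂ) * Complex.I)) := by
        rw [Complex.star_def, ← Complex.exp_conj]; simp
      rw [this, ← Complex.exp_add]
      congr 1
      push_cast; ring
    simp only [SuperNonDegPhases, hratio] at hS
    have hz : ∀ a, (fun a => Complex.exp (((θ a : ℝ) : ℂ) * Complex.I)) a *
      star ((fun a => Complex.exp (((θ a : ℝ) : ℂ) * Complex.I)) a) = 1 := fun a => hunit _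
    have hz' : ∀ a, (fun a => Complex.exp (((θ' a : ℝ) : ℂ) * Complex.I)) a *
      star ((fun a => Complex.exp (((θ' a : ℝ) : ℂ) * Complex.I)) a) = 1 := fun a => hunit _
    generalize hzd : (fun a => Complex.exp (((θ a : ℝ) : ℂ) * Complex.I)) = z at *
    generalize hzd' : (fun a => Complex.exp (((θ' a : ℝ) : ℂ) * Complex.I)) = z' at *
    have snd : ∀ c d' e f : Fin d, c ≠ d' → e ≠ f → c ≠ f → d' ≠ e → ∀ a b,
        z c * star (z d') * (z e * star (z f)) ≠ z a * star (z b) := by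
      intro c d' e f h1 h2 h3 h4 a b
      have := hS c d' e f h1 h2 h3 h4 a b
      simpa only [← hzd] using this
    have hdist : ∀ a b, a ≠ b → z a ≠ z b := by
      intro a b hab he
      apply snd a b a b hab hab hab hab.symm a a
      rw [he, hz]; ring
    have hvv : vᴴ * v = 1 := (Unitary.mem_iff.1 hv).1
    have hvv' : v'ᴴ * v' = 1 := (Unitary.mem_iff.1 hv').1
    have hvr : v * vᴴ = 1 := (Unitary.mem_iff.1 hv).2
    have hvr' : v' * v'ᴴ = 1 := (Unitary.mem_iff.1 hv').2
    have hT : ∀ A, T (u' * A * u'ᴴ) = u * T A * uᴴ := by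
      intro A
      rw [← hU', ← hUdef]; simp
    let L : Mat d →ₗ[ℂ] Mat d :=
      { toFun := fun A => vᴴ * T (v' * A * v'ᴴ) * v
        map_add' := by
          intro A B
          simp only [Matrix.mul_add, Matrix.add_mul, map_add]
        map_smul' := by
          intro c A
          simp only [Matrix.mul_smul, Matrix.smul_mul, map_smul, RingHom.id_apply] }
    have hLdef : ∀ A, L A = vᴴ * T (v' * A * v'ᴴ) * v := fun A => rfl
    have hLinj : Function.Injective L := by
      rw [injective_iff_map_eq_zero]
      intro A hA
      rw [hLdef] at hA
      have h1 : T (v' * A * v'ᴴ) = 0 := by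
        calc T (v' * A * v'ᴴ) = (v * vᴴ) * T (v' * A * v'ᴴ) * (v * vᴴ) := by
              rw [hvr]; simp
          _ = v * (vᴴ * T (v' * A * v'ᴴ) * v) * vᴴ := by simp only [Matrix.mul_assoc]
          _ = 0 := by rw [hA]; simp
      have h2 : v' * A * v'ᴴ = 0 := by simpa using h1
      calc A = (v'ᴴ * v') * A * (v'ᴴ * v') := by rw [hvv']; simp
        _ = v'ᴴ * (v' * A * v'ᴴ) * v' := by simp only [Matrix.mul_assoc]
        _ = 0 := by rw [h2]; simp
    have hintM : ∀ A, Matrix.diagonal z * L A * (Matrix.diagonal z)ᴴ =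
        L (Matrix.diagonal z' * A * (Matrix.diagonal z')ᴴ) := by
      intro A
      have e1 : v' * (Matrix.diagonal z' * A * (Matrix.diagonal z')ᴴ) * v'ᴴ =
          u' * (v' * A * v'ᴴ) * u'ᴴ := by
        have e2 : u' * v' = v' * Matrix.diagonal z' := by
          rw [huv', Matrix.mul_assoc, hvv', Matrix.mul_one]
        have e3 := congrArg Matrix.conjTranspose e2
        rw [Matrix.conjTranspose_mul, Matrix.conjTranspose_mul] at e3
        calc _ = (v' * Matrix.diagonal z') * A * ((Matrix.diagonal z')ᴴ * v'ᴴ) := by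
              simp only [Matrix.mul_assoc]
          _ = _ := by rw [← e2, ← e3]; simp only [Matrix.mul_assoc]
      have e2 : vᴴ * u = Matrix.diagonal z * vᴴ := by
        rw [huv, ← Matrix.mul_assoc, ← Matrix.mul_assoc, hvv, Matrix.one_mul]
      have e3 := congrArg Matrix.conjTranspose e2
      rw [Matrix.conjTranspose_mul, Matrix.conjTranspose_mul, Matrix.conjTranspose_conjTranspose] at e3
      rw [hLdef, hLdef, e1, hT]
      calc _ = (Matrix.diagonal z * vᴴ) * T (v' * A * v'ᴴ) * (v * (Matrix.diagonal z)ᴴ) := by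
              simp only [Matrix.mul_assoc]
          _ = _ := by rw [← e2, ← e3]; simp only [Matrix.mul_assoc]
    have hint : ∀ A i j, z i * star (z j) * L A i j =
        L (Matrix.diagonal z' * A * (Matrix.diagonal z')ᴴ) i j := by
      intro A i j
      rw [← hintM, Matrix.diagonal_conjTranspose, Matrix.mul_diagonal, Matrix.diagonal_mul,
        Pi.star_apply]
      ring
    obtain ⟨hr, hinj⟩ := inter_spec z z' hz hz' hdist L hLinj hint
    obtain ⟨σ, l, hl, hcase⟩ := comb hd z z' hz hz' snd hr hinj
    obtain ⟨v₂, hv₂, hvσ⟩ := conj_perm z v hv σ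
    rw [← huv] at hvσ
    have hv₂v : v₂ᴴ * v₂ = 1 := (Unitary.mem_iff.1 hv₂).1
    have hfin : ∀ m A : Mat d, u' = l • m → u' * A * u'ᴴ = m * A * mᴴ := by
      intro m A hm
      rw [hm, Matrix.conjTranspose_smul, Matrix.smul_mul, Matrix.smul_mul, Matrix.mul_smul,
        smul_smul, hl, one_smul]
    have hTU : ∀ A, T.symm (U (T A)) = u' * A * u'ᴴ := fun A => hU' A
    rcases hcase with hc | hc
    · refine ⟨v₂ * v'ᴴ, mul_mem hv₂ (Unitary.star_mem hv'), false, ?_⟩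
      intro A
      rw [hTU, hUdef, Sconj]
      apply hfin
      have hD : Matrix.diagonal z' = l • Matrix.diagonal (fun a => z (σ a)) := by
        rw [← Matrix.diagonal_smul]
        congr 1
        funext a
        simpa using hc a
      simp only [Bool.false_eq_true, if_false]
      rw [huv', hD, hvσ, Matrix.mul_smul, Matrix.smul_mul]
      congr 1
      rw [Matrix.conjTranspose_mul, Matrix.conjTranspose_conjTranspose]
      calc _ = v' * 1 * Matrix.diagonal (fun a => z (σ a)) * 1 * v'ᴴ := by simp
        _ = _ := by rw [← hv₂v]; simp only [Matrix.mul_assoc]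
    · refine ⟨v₂ * v'ᵀ, mul_mem hv₂ (Matrix.transpose_mem_unitaryGroup_iff.2 hv'), true, ?_⟩
      intro A
      rw [hTU, hUdef, Sconj]
      apply hfin
      have hD : Matrix.diagonal z' = l • (Matrix.diagonal (fun a => z (σ a)))ᴴ := by
        rw [Matrix.diagonal_conjTranspose, ← Matrix.diagonal_smul]
        congr 1
        funext a
        simpa using hc a
      simp only [if_true]
      rw [huv', hD, hvσ, Matrix.mul_smul, Matrix.smul_mul]
      congr 1
      have hsymm : ((Matrix.diagonal (fun a => z (σ a)))ᴴ)ᵀ =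
          (Matrix.diagonal (fun a => z (σ a)))ᴴ := by
        rw [Matrix.diagonal_conjTranspose, Matrix.diagonal_transpose]
      have hin : (v₂ * v'ᵀ)ᴴ * (v₂ * Matrix.diagonal (fun a => z (σ a)) * v₂ᴴ)ᴴ * (v₂ * v'ᵀ) =
          (v'ᵀ)ᴴ * (Matrix.diagonal (fun a => z (σ a)))ᴴ * v'ᵀ := by
        rw [Matrix.conjTranspose_mul, Matrix.conjTranspose_mul, Matrix.conjTranspose_mul,
          Matrix.conjTranspose_conjTranspose]
        calc _ = (v'ᵀ)ᴴ * (v₂ᴴ * v₂) * (Matrix.diagonal (fun a => z (σ a)))ᴴ * (v₂ᴴ * v₂) * v'ᵀ := by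
              simp only [Matrix.mul_assoc]
          _ = _ := by rw [hv₂v]; simp only [Matrix.mul_one]
      rw [hin, Matrix.transpose_mul, Matrix.transpose_mul, hsymm, Matrix.transpose_transpose,
        Matrix.mul_assoc]
      rfl
  · rintro ⟨w, hw, anti, h⟩
    refine ⟨if anti then (wᴴ * uᴴ * w)ᵀ else wᴴ * u * w, ?_, ?_⟩
    · cases anti
      · exact mul_mem (mul_mem (Unitary.star_mem hw) hu) hw
      · exact Matrix.transpose_mem_unitaryGroup_iff.2
          (mul_mem (mul_mem (Unitary.star_mem hw) (Unitary.star_mem hu)) hw)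
    · intro A
      rw [← Sconj, ← hUdef]
      exact h A
end
end
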